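/- arXiv:2108.07643 — 2 statements merged into one kernel-verified Lean document; each statement's English description precedes it below -/
import Mathlib

section
/- Let Ψ:[-1,1]→ℝ have a real analytic extension to an open neighbourhood of [-1,1], let Γ = {(x,Ψ(x)) : x∈(-1,1)} and Ω = {(x,y)∈(-1,1)×ℝ : y<Ψ(x)}, and let n be the unit normal to Γ pointing away from Ω. Let g,h ∈ C¹([-1,1]). If there exists an open connected neighbourhood U ⊂ ℝ² of Γ and a function u ∈ C²(U∖cl(Ω)) ∩ C¹(U∖Ω) with Δu = 0 on U∖cl(Ω), u(x,Ψ(x)) = g(x) and (∂u/∂n)(x,Ψ(x)) = h(x) for all x∈(-1,1), then the function H(x) := g(x) − (1/π)∫_{-1}^{1} h(t)√(1+Ψ'(t)²) · log√((x−t)² + (Ψ(x)−Ψ(t))²) dt is real analytic on (-1,1). -/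
open MeasureTheory Filter Topology Set

/-- Partial derivative in the first coordinate. -/
noncomputable def pdx (F : ℝ × ℝ → ℝ) (p : ℝ × ℝ) : ℝ :=
  deriv (fun x => F (x, p.2)) p.1

/-- Partial derivative in the second coordinate. -/
noncomputable def pdy (F : ℝ × ℝ → ℝ) (p : ℝ × ℝ) : ℝ :=
  deriv (fun y => F (p.1, y)) p.2

/-- The Laplacian on `ℝ × ℝ`. -/
noncomputable def lap (F : ℝ × ℝ → ℝ) (p : ℝ × ℝ) : ℝ :=
  pdx (pdx F) p + pdy (pdy F) p

theorem exists_complex_extension {ψ : ℝ → ℝ} {x₀ : ℝ} (hψ : AnalyticAt ℝ ψ x₀) :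
    ∃ F : ℂ → ℂ, AnalyticAt ℂ F x₀ ∧ ∀ᶠ x : ℝ in 𝓝 x₀, F x = ψ x := by
  obtain ⟨p, hp⟩ := hψ
  rw [hasFPowerSeriesAt_iff] at hp
  obtain ⟨ε, hε, hb⟩ := Metric.eventually_nhds_iff.1 hp
  have key : ∀ z : ℂ, ‖z‖ < ε → Summable (fun n => z ^ n * (p.coeff n : ℂ)) := by
    intro z hz
    have h1 := (hb (y := ‖z‖) (by simpa using hz)).summable.norm
    refine Summable.of_norm ?_
    refine h1.congr fun n => ?_
    simp
  refine ⟨fun z => ∑' n, (z - x₀) ^ n * (p.coeff n : ℂ), ?_, ?_⟩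
  · refine ⟨FormalMultilinearSeries.ofScalars ℂ (fun n => (p.coeff n : ℂ)), ?_⟩
    rw [hasFPowerSeriesAt_iff]
    refine Metric.eventually_nhds_iff.2 ⟨ε, hε, fun z hz => ?_⟩
    have := (key z (by simpa using hz)).hasSum
    simpa [FormalMultilinearSeries.coeff_ofScalars] using this
  · refine Metric.eventually_nhds_iff.2 ⟨ε, hε, fun x hx => ?_⟩
    have h1 := hb (y := x - x₀) (by simpa [dist_eq_norm] using hx)
    have h2 := (Complex.hasSum_ofReal.2 h1).tsum_eq
    simpa using h2

theorem hasDerivAt_intervalIntegral_of_continuousOn {S : Set ℂ} (hS : IsOpen S) {p q : ℝ}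
    (hpq : p ≤ q) {G : ℂ → ℝ → ℂ}
    (hc : ContinuousOn (fun w : ℂ × ℝ => G w.1 w.2) (S ×ˢ Icc p q))
    (hd : ∀ t ∈ Icc p q, DifferentiableOn ℂ (fun z => G z t) S) {z₀ : ℂ} (hz : z₀ ∈ S) :
    HasDerivAt (fun z => ∫ t in p..q, G z t) (∫ t in p..q, deriv (fun z => G z t) z₀) z₀ := by
  obtain ⟨R, hR, hRS⟩ := Metric.nhds_basis_closedBall.mem_iff.1 (hS.mem_nhds hz)
  have hcpt : IsCompact (Metric.closedBall z₀ R ×ˢ Icc p q) :=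
    (isCompact_closedBall _ _).prod isCompact_Icc
  obtain ⟨M, hM⟩ := hcpt.exists_bound_of_continuousOn
    (hc.mono (prod_mono hRS Subset.rfl))
  have hct : ∀ z ∈ S, ContinuousOn (G z) (Icc p q) := fun z hz =>
    hc.comp (f := fun t : ℝ => (z, t)) (by fun_prop) fun t ht => ⟨hz, ht⟩
  have hsub : Set.uIoc p q ⊆ Icc p q := by rw [uIoc_of_le hpq]; exact Ioc_subset_Icc_self
  have hmeas : ∀ z ∈ S, AEStronglyMeasurable (G z) (volume.restrict (Set.uIoc p q)) := fun z hz =>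
    ((hct z hz).mono hsub).aestronglyMeasurable measurableSet_uIoc
  have hR2 : 0 < R / 2 := by positivity
  have hball : Metric.ball z₀ (R / 2) ⊆ S :=
    (Metric.ball_subset_closedBall.trans (Metric.closedBall_subset_closedBall (by linarith))).trans
      hRS
  have hda : ∀ t ∈ Icc p q, ∀ z ∈ S, HasDerivAt (fun z => G z t) (deriv (fun z => G z t) z) z :=
    fun t ht z hz => ((hd t ht).differentiableAt (hS.mem_nhds hz)).hasDerivAt
  refine (intervalIntegral.hasDerivAt_integral_of_dominated_loc_of_deriv_le
    (F := G) (F' := fun z t => deriv (fun z => G z t) z) (bound := fun _ => M / (R / 2))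
    (Metric.ball_mem_nhds z₀ hR2) ?_ ?_ ?_ ?_ ?_ ?_).2
  · filter_upwards [hS.mem_nhds hz] with z hz using hmeas z hz
  · exact (hct z₀ hz).intervalIntegrable_of_Icc hpq
  · obtain ⟨v, -, hv0, hv⟩ := exists_seq_strictAnti_tendsto' (show (0 : ℝ) < 1 by norm_num)
    have hv' : Tendsto (fun n => ((v n : ℝ) : ℂ)) atTop (𝓝[≠] 0) := by
      refine tendsto_nhdsWithin_iff.2 ⟨?_, Eventually.of_forall fun n => ?_⟩
      · simpa [Function.comp_def] using (Complex.continuous_ofReal.tendsto 0).comp hv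
      · have := (hv0 n).1; simpa using this.ne'
    have hS' : ∀ᶠ n in atTop, z₀ + (v n : ℂ) ∈ S := by
      have : Tendsto (fun n => z₀ + (v n : ℂ)) atTop (𝓝 (z₀ + 0)) :=
        tendsto_const_nhds.add (hv'.mono_right nhdsWithin_le_nhds)
      exact this.eventually (by simpa using hS.mem_nhds hz)
    obtain ⟨N, hN⟩ := eventually_atTop.1 hS'
    refine aestronglyMeasurable_of_tendsto_ae atTop
      (f := fun n t => ((v (n + N) : ℂ))⁻¹ * (G (z₀ + v (n + N)) t - G z₀ t)) (fun n => ?_) ?_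
    · exact ((hmeas _ (hN (n + N) (Nat.le_add_left _ _))).sub (hmeas _ hz)).const_mul _
    · refine (ae_restrict_iff' measurableSet_uIoc).2 (Eventually.of_forall fun t ht => ?_)
      have := (hasDerivAt_iff_tendsto_slope_zero.1 (hda t (hsub ht) z₀ hz)).comp hv'
      exact this.comp (tendsto_add_atTop_nat N)
  · refine Eventually.of_forall fun t ht z hz => ?_
    refine Complex.norm_deriv_le_of_forall_mem_sphere_norm_le hR2 ?_ ?_
    · refine DifferentiableOn.diffContOnCl ((hd t (hsub ht)).mono ?_)
      rw [closure_ball _ hR2.ne']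
      refine (Metric.closedBall_subset_closedBall' ?_).trans hRS
      have := Metric.mem_ball.1 hz; linarith
    · intro w hw
      refine hM (w, t) ⟨?_, hsub ht⟩
      have h1 := Metric.mem_ball.1 hz
      have h2 := Metric.mem_sphere.1 hw
      have := dist_triangle w z z₀
      simp only [Metric.mem_closedBall]; linarith
  · exact intervalIntegrable_const
  · exact Eventually.of_forall fun t ht z hz => hda t (hsub ht) z (hball hz)

theorem integral_inv_affine_eq_log_sub_log {c e : ℂ} {p q : ℝ}
    (h : ∀ x ∈ uIcc p q, e + x * c ∈ Complex.slitPlane) :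
    c * ∫ x in p..q, (e + x * c)⁻¹ = Complex.log (e + q * c) - Complex.log (e + p * c) := by
  rw [← intervalIntegral.integral_const_mul]
  refine intervalIntegral.integral_eq_sub_of_hasDerivAt
    (f := fun x : ℝ => Complex.log (e + x * c)) (fun x hx => ?_) ?_
  · have h1 : HasDerivAt (fun y : ℝ => e + y * c) c x := by
      simpa using ((Complex.ofRealCLM.hasDerivAt (x := x)).mul_const c).const_add e
    simpa [div_eq_mul_inv] using h1.clog_real (h x hx)
  · refine ContinuousOn.intervalIntegrable ?_
    refine continuousOn_const.mul (ContinuousOn.inv₀ (by fun_prop) fun x hx => ?_)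
    exact Complex.slitPlane_ne_zero (h x hx)

/-- The integral over the boundary of the rectangle `[a, b] × [0, d]`, counterclockwise. -/
noncomputable def rectIntegral (a b d : ℝ) (f : ℂ → ℂ) : ℂ :=
  (∫ x in a..b, f x) - (∫ x in a..b, f (x + d * Complex.I)) +
    Complex.I * (∫ y in (0 : ℝ)..d, f (b + y * Complex.I)) -
    Complex.I * ∫ y in (0 : ℝ)..d, f (a + y * Complex.I)

theorem rectIntegral_eq_zero {a b d : ℝ} (hab : a ≤ b) (hd : 0 ≤ d) {f : ℂ → ℂ} {s : Set ℂ}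
    (hs : s.Countable) (hc : ContinuousOn f (Icc a b ×ℂ Icc 0 d))
    (hf : ∀ z ∈ (Ioo a b ×ℂ Ioo 0 d) \ s, DifferentiableAt ℂ f z) :
    rectIntegral a b d f = 0 := by
  have := Complex.integral_boundary_rect_eq_zero_of_differentiable_on_off_countable f
    (a : ℂ) (b + d * Complex.I) s hs (by simpa [uIcc_of_le, hab, hd] using hc)
    (by simpa [hab, hd] using hf)
  simpa [rectIntegral] using this

theorem log_sub_log_neg_of_im_pos {w : ℂ} (h : 0 < w.im) :
    Complex.log w - Complex.log (-w) = Real.pi * Complex.I := by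
  rw [Complex.log, Complex.log, Complex.arg_neg_eq_arg_sub_pi_of_im_pos h, norm_neg]
  push_cast; ring

theorem rectIntegral_inv_sub {a b d : ℝ} {z : ℂ} (hz : z ∈ Ioo a b ×ℂ Ioo 0 d) :
    rectIntegral a b d (fun w => (w - z)⁻¹) = 2 * Real.pi * Complex.I := by
  obtain ⟨⟨h1, h2⟩, h3, h4⟩ := hz
  have e1 : (∫ x in a..b, ((x : ℂ) - z)⁻¹) = Complex.log (b - z) - Complex.log (a - z) := by
    have := integral_inv_affine_eq_log_sub_log (c := 1) (e := -z) (p := a) (q := b)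
      (fun x _ => Complex.mem_slitPlane_iff.2 (Or.inr (by simpa using h3.ne')))
    simpa [neg_add_eq_sub] using this
  have e2 : (∫ x in a..b, ((x : ℂ) + d * Complex.I - z)⁻¹) =
      Complex.log (b + d * Complex.I - z) - Complex.log (a + d * Complex.I - z) := by
    have := integral_inv_affine_eq_log_sub_log (c := 1) (e := d * Complex.I - z) (p := a) (q := b)
      (fun x _ => Complex.mem_slitPlane_iff.2 (Or.inr (by simpa using (sub_pos.2 h4).ne')))
    simpa [add_sub_assoc, add_comm] using this
  have e3 : Complex.I * (∫ y in (0 : ℝ)..d, ((b : ℂ) + y * Complex.I - z)⁻¹) =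
      Complex.log (b + d * Complex.I - z) - Complex.log (b - z) := by
    have := integral_inv_affine_eq_log_sub_log (c := Complex.I) (e := b - z) (p := 0) (q := d)
      (fun x _ => Complex.mem_slitPlane_iff.2 (Or.inl (by simpa using h2)))
    simpa [sub_add_eq_add_sub] using this
  have e4 : Complex.I * (∫ y in (0 : ℝ)..d, ((a : ℂ) + y * Complex.I - z)⁻¹) =
      Complex.log (-(a + d * Complex.I - z)) - Complex.log (-(a - z)) := by
    have := integral_inv_affine_eq_log_sub_log (c := -Complex.I) (e := -(a - z)) (p := 0) (q := d)
      (fun x _ => Complex.mem_slitPlane_iff.2 (Or.inl (by simpa using h1)))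
    have h5 : ∀ y : ℝ, -((a : ℂ) - z) + y * -Complex.I = -(a + y * Complex.I - z) := by
      intro y; ring
    simp only [h5, inv_neg, intervalIntegral.integral_neg, neg_mul_neg] at this
    simpa using this
  have h6 := log_sub_log_neg_of_im_pos (w := a + d * Complex.I - z) (by simpa using h4)
  have h7 := log_sub_log_neg_of_im_pos (w := -(a - z)) (by simpa using h3)
  rw [neg_neg] at h7
  rw [rectIntegral, e1, e2, e3, e4]
  linear_combination h6 + h7

/-- The boundary of the rectangle `[a, b] × [0, d]`. -/
def rectBoundary (a b d : ℝ) : Set ℂ := (Icc a b ×ℂ Icc 0 d) \ (Ioo a b ×ℂ Ioo 0 d)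

theorem mem_rectBoundary {a b d : ℝ} (hab : a ≤ b) (hd : 0 ≤ d) :
    (∀ x ∈ Icc a b, (x : ℂ) ∈ rectBoundary a b d) ∧
    (∀ x ∈ Icc a b, (x + d * Complex.I : ℂ) ∈ rectBoundary a b d) ∧
    (∀ y ∈ Icc 0 d, (b + y * Complex.I : ℂ) ∈ rectBoundary a b d) ∧
    (∀ y ∈ Icc 0 d, (a + y * Complex.I : ℂ) ∈ rectBoundary a b d) := by
  refine ⟨fun x hx => ?_, fun x hx => ?_, fun x hx => ?_, fun x hx => ?_⟩ <;>
  · obtain ⟨h1, h2⟩ := hx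
    simp [rectBoundary, Complex.mem_reProdIm, *]

theorem ContinuousOn.comp_rectBoundary {a b d : ℝ} (hab : a ≤ b) (hd : 0 ≤ d) {f : ℂ → ℂ}
    (hf : ContinuousOn f (rectBoundary a b d)) :
    ContinuousOn (fun x : ℝ => f x) (Icc a b) ∧
    ContinuousOn (fun x : ℝ => f (x + d * Complex.I)) (Icc a b) ∧
    ContinuousOn (fun y : ℝ => f (b + y * Complex.I)) (Icc 0 d) ∧
    ContinuousOn (fun y : ℝ => f (a + y * Complex.I)) (Icc 0 d) := by
  obtain ⟨h1, h2, h3, h4⟩ := mem_rectBoundary hab hd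
  exact ⟨hf.comp (by fun_prop) h1, hf.comp (by fun_prop) h2, hf.comp (by fun_prop) h3,
    hf.comp (by fun_prop) h4⟩

theorem rectIntegral_congr {a b d : ℝ} (hab : a ≤ b) (hd : 0 ≤ d) {f g : ℂ → ℂ}
    (h : EqOn f g (rectBoundary a b d)) : rectIntegral a b d f = rectIntegral a b d g := by
  obtain ⟨h1, h2, h3, h4⟩ := mem_rectBoundary hab hd
  rw [rectIntegral, rectIntegral]
  congr 1
  · congr 1
    · congr 1 <;> refine intervalIntegral.integral_congr fun x hx => ?_ <;>
        rw [uIcc_of_le hab] at hx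
      exacts [h (h1 x hx), h (h2 x hx)]
    · congr 1
      refine intervalIntegral.integral_congr fun x hx => ?_
      rw [uIcc_of_le hd] at hx
      exact h (h3 x hx)
  · congr 1
    refine intervalIntegral.integral_congr fun x hx => ?_
    rw [uIcc_of_le hd] at hx
    exact h (h4 x hx)

theorem rectIntegral_sub_const_mul {a b d : ℝ} (hab : a ≤ b) (hd : 0 ≤ d) {f g : ℂ → ℂ} (c : ℂ)
    (hf : ContinuousOn f (rectBoundary a b d)) (hg : ContinuousOn g (rectBoundary a b d)) :
    rectIntegral a b d (fun w => f w - c * g w) =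
      rectIntegral a b d f - c * rectIntegral a b d g := by
  obtain ⟨f1, f2, f3, f4⟩ := hf.comp_rectBoundary hab hd
  obtain ⟨g1, g2, g3, g4⟩ := (continuousOn_const (c := c).fun_mul hg).comp_rectBoundary hab hd
  simp only [rectIntegral]
  rw [intervalIntegral.integral_sub (f1.intervalIntegrable_of_Icc hab)
      (g1.intervalIntegrable_of_Icc hab),
    intervalIntegral.integral_sub (f2.intervalIntegrable_of_Icc hab)
      (g2.intervalIntegrable_of_Icc hab),
    intervalIntegral.integral_sub (f3.intervalIntegrable_of_Icc hd)
      (g3.intervalIntegrable_of_Icc hd),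
    intervalIntegral.integral_sub (f4.intervalIntegrable_of_Icc hd)
      (g4.intervalIntegrable_of_Icc hd)]
  simp only [intervalIntegral.integral_const_mul]
  ring

/-- **Cauchy's integral formula** for a rectangle. -/
theorem rectIntegral_mul_inv_sub {a b d : ℝ} {f : ℂ → ℂ} {z : ℂ}
    (hc : ContinuousOn f (Icc a b ×ℂ Icc 0 d))
    (hf : ∀ z ∈ Ioo a b ×ℂ Ioo 0 d, DifferentiableAt ℂ f z) (hz : z ∈ Ioo a b ×ℂ Ioo 0 d) :
    rectIntegral a b d (fun w => f w * (w - z)⁻¹) = 2 * Real.pi * Complex.I * f z := by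
  have hnhd : Ioo a b ×ℂ Ioo 0 d ∈ 𝓝 z := (isOpen_Ioo.reProdIm isOpen_Ioo).mem_nhds hz
  have hab : a ≤ b := (hz.1.1.trans hz.1.2).le
  have hd : 0 ≤ d := (hz.2.1.trans hz.2.2).le
  have hnhd' : Icc a b ×ℂ Icc 0 d ∈ 𝓝 z :=
    mem_of_superset hnhd fun w hw => ⟨Ioo_subset_Icc_self hw.1, Ioo_subset_Icc_self hw.2⟩
  have h0 : rectIntegral a b d (dslope f z) = 0 := by
    refine rectIntegral_eq_zero hab hd (countable_singleton z)
      ((continuousOn_dslope hnhd').2 ⟨hc, hf z hz⟩) fun w hw => ?_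
    exact (differentiableAt_dslope_of_ne hw.2).2 (hf w hw.1)
  have hne : ∀ w ∈ rectBoundary a b d, w - z ≠ 0 := fun w hw h =>
    hw.2 (sub_eq_zero.1 h ▸ hz)
  have hinv : ContinuousOn (fun w => (w - z)⁻¹) (rectBoundary a b d) :=
    ContinuousOn.inv₀ (by fun_prop) hne
  have hds : EqOn (dslope f z) (fun w => f w * (w - z)⁻¹ - f z * (w - z)⁻¹)
      (rectBoundary a b d) := fun w hw => by
    rw [dslope_of_ne _ (sub_ne_zero.1 (hne w hw)), slope_def_field]; ring
  rw [rectIntegral_congr hab hd hds, rectIntegral_sub_const_mul hab hd (f z)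
    ((hc.mono sdiff_subset).fun_mul hinv) hinv, rectIntegral_inv_sub hz] at h0
  linear_combination h0

theorem rectIntegral_mul_inv_sub_of_im_neg {a b d : ℝ} (hab : a ≤ b) (hd : 0 ≤ d) {f : ℂ → ℂ}
    {z : ℂ} (hc : ContinuousOn f (Icc a b ×ℂ Icc 0 d))
    (hf : ∀ z ∈ Ioo a b ×ℂ Ioo 0 d, DifferentiableAt ℂ f z) (hz : z.im < 0) :
    rectIntegral a b d (fun w => f w * (w - z)⁻¹) = 0 := by
  have hne : ∀ w ∈ Icc a b ×ℂ Icc 0 d, w - z ≠ 0 := fun w hw h => by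
    have := hw.2.1
    rw [sub_eq_zero.1 h] at this
    exact absurd hz (not_lt.2 this)
  refine rectIntegral_eq_zero hab hd countable_empty
    (hc.mul (ContinuousOn.inv₀ (by fun_prop) hne)) fun w hw => ?_
  refine (hf w hw.1).mul (DifferentiableAt.inv (by fun_prop) (hne w ?_))
  exact ⟨Ioo_subset_Icc_self hw.1.1, Ioo_subset_Icc_self hw.1.2⟩

theorem conj_rectIntegral {a b d : ℝ} {f : ℂ → ℂ} :
    starRingEnd ℂ (rectIntegral a b d f) =
      (∫ x in a..b, starRingEnd ℂ (f x)) - (∫ x in a..b, starRingEnd ℂ (f (x + d * Complex.I))) -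
      Complex.I * (∫ y in (0 : ℝ)..d, starRingEnd ℂ (f (b + y * Complex.I))) +
      Complex.I * ∫ y in (0 : ℝ)..d, starRingEnd ℂ (f (a + y * Complex.I)) := by
  simp only [rectIntegral, intervalIntegral, map_sub, map_add, map_mul, Complex.conj_I,
    integral_conj]
  ring

theorem differentiableOn_integral_mul_inv_sub {p q : ℝ} (hpq : p ≤ q) {c γ : ℝ → ℂ} {x₀ : ℂ} {δ : ℝ}
    (hc : ContinuousOn c (Icc p q)) (hγ : ContinuousOn γ (Icc p q))
    (h : ∀ s ∈ Icc p q, δ ≤ ‖γ s - x₀‖) :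
    DifferentiableOn ℂ (fun z => ∫ s in p..q, c s * (γ s - z)⁻¹) (Metric.ball x₀ δ) := by
  have hne : ∀ s ∈ Icc p q, ∀ z ∈ Metric.ball x₀ δ, γ s - z ≠ 0 := fun s hs z hz h' => by
    have h1 := h s hs
    rw [sub_eq_zero.1 h', ← dist_eq_norm] at h1
    exact absurd (Metric.mem_ball.1 hz) (not_lt.2 h1)
  intro z hz
  refine (hasDerivAt_intervalIntegral_of_continuousOn (G := fun z s => c s * (γ s - z)⁻¹)
    Metric.isOpen_ball hpq ?_ ?_ hz).differentiableAt.differentiableWithinAt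
  · have h1 : MapsTo Prod.snd (Metric.ball x₀ δ ×ˢ Icc p q) (Icc p q) := fun w hw => hw.2
    refine (hc.comp continuousOn_snd h1).mul (ContinuousOn.inv₀ ?_ fun w hw => ?_)
    · exact (hγ.comp continuousOn_snd h1).sub continuousOn_fst
    · exact hne w.2 hw.2 w.1 hw.1
  · intro t ht w hw
    refine (DifferentiableAt.const_mul (DifferentiableAt.inv (by fun_prop) ?_)
      _).differentiableWithinAt
    exact hne t ht w hw

/-- A holomorphic function on a rectangle is, up to a function that is holomorphic across the
bottom side, the Cauchy integral of its imaginary part along this side. -/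
theorem exists_eq_cauchy_integral_im_add {a b d x₀ δ : ℝ} {f : ℂ → ℂ}
    (hδ : 0 < δ) (hδa : δ ≤ x₀ - a) (hδb : δ ≤ b - x₀) (hδd : δ ≤ d)
    (hc : ContinuousOn f (Icc a b ×ℂ Icc 0 d))
    (hf : ∀ z ∈ Ioo a b ×ℂ Ioo 0 d, DifferentiableAt ℂ f z) :
    ∃ T : ℂ → ℂ, DifferentiableOn ℂ T (Metric.ball x₀ δ) ∧ ∀ z ∈ Ioo a b ×ℂ Ioo 0 d,
      f z = (1 / Real.pi) * (∫ t in a..b, ((f t).im : ℂ) * (t - z)⁻¹) + T z := by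
  have hab : a ≤ b := by linarith
  have hd : 0 ≤ d := by linarith
  obtain ⟨f1, f2, f3, f4⟩ := (hc.mono sdiff_subset :
    ContinuousOn f (rectBoundary a b d)).comp_rectBoundary hab hd
  have cc : ∀ {g : ℝ → ℂ} {s : Set ℝ}, ContinuousOn g s →
    ContinuousOn (fun t => starRingEnd ℂ (g t)) s := fun hg =>
      Complex.continuous_conj.comp_continuousOn hg
  have him : ∀ {w : ℂ}, δ ≤ |w.im| → δ ≤ ‖w‖ := fun hw => hw.trans (Complex.abs_im_le_norm _)
  have hre : ∀ {w : ℂ}, δ ≤ |w.re| → δ ≤ ‖w‖ := fun hw => hw.trans (Complex.abs_re_le_norm _)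
  have T1 := differentiableOn_integral_mul_inv_sub (x₀ := x₀) (δ := δ) hab f2
    (γ := fun x => x + d * Complex.I) (by fun_prop)
    (fun s _ => him (by simpa using hδd.trans (le_abs_self d)))
  have T2 := differentiableOn_integral_mul_inv_sub (x₀ := x₀) (δ := δ) hab (cc f2)
    (γ := fun x => x - d * Complex.I) (by fun_prop)
    (fun s _ => him (by simpa using hδd.trans (le_abs_self d)))
  have T3 := differentiableOn_integral_mul_inv_sub (x₀ := x₀) (δ := δ) hd f3
    (γ := fun y => b + y * Complex.I) (by fun_prop)
    (fun s _ => hre (by simpa using hδb.trans (le_abs_self _)))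
  have T4 := differentiableOn_integral_mul_inv_sub (x₀ := x₀) (δ := δ) hd (cc f3)
    (γ := fun y => b - y * Complex.I) (by fun_prop)
    (fun s _ => hre (by simpa using hδb.trans (le_abs_self _)))
  have T5 := differentiableOn_integral_mul_inv_sub (x₀ := x₀) (δ := δ) hd f4
    (γ := fun y => a + y * Complex.I) (by fun_prop)
    (fun s _ => hre (by simpa [abs_sub_comm] using hδa.trans (le_abs_self _)))
  have T6 := differentiableOn_integral_mul_inv_sub (x₀ := x₀) (δ := δ) hd (cc f4)
    (γ := fun y => a - y * Complex.I) (by fun_prop)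
    (fun s _ => hre (by simpa [abs_sub_comm] using hδa.trans (le_abs_self _)))
  refine ⟨_, ((((T2.sub T1).add ((T3.add T4).const_mul Complex.I)).sub
    ((T5.add T6).const_mul Complex.I)).const_mul (2 * Real.pi * Complex.I)⁻¹), fun z hz => ?_⟩
  have h1 := rectIntegral_mul_inv_sub hc hf hz
  have h2 := congrArg (starRingEnd ℂ) (rectIntegral_mul_inv_sub_of_im_neg (z := starRingEnd ℂ z)
    hab hd hc hf (by simpa using hz.2.1))
  rw [conj_rectIntegral] at h2
  simp only [map_mul, map_inv₀, map_sub, map_add, Complex.conj_conj, Complex.conj_ofReal,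
    Complex.conj_I, map_zero, mul_neg, ← sub_eq_add_neg] at h2
  rw [rectIntegral] at h1
  have hne : ∀ t ∈ Icc a b, (t : ℂ) - z ≠ 0 := fun t _ h => by
    have := hz.2.1
    rw [← sub_eq_zero.1 h] at this
    simp at this
  have hinv : ContinuousOn (fun t : ℝ => ((t : ℂ) - z)⁻¹) (Icc a b) :=
    ContinuousOn.inv₀ (by fun_prop) hne
  have h3 : (∫ t in a..b, f t * (t - z)⁻¹) - (∫ t in a..b, starRingEnd ℂ (f t) * (t - z)⁻¹) =
      2 * Complex.I * ∫ t in a..b, ((f t).im : ℂ) * (t - z)⁻¹ := by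
    rw [← intervalIntegral.integral_sub ((f1.fun_mul hinv).intervalIntegrable_of_Icc hab)
      (((cc f1).fun_mul hinv).intervalIntegrable_of_Icc hab), ← intervalIntegral.integral_const_mul]
    refine intervalIntegral.integral_congr fun t _ => ?_
    have := Complex.sub_conj (f t)
    push_cast at this
    linear_combination ((t : ℂ) - z)⁻¹ * this
  have hpi : (Real.pi : ℂ) ≠ 0 := by exact_mod_cast Real.pi_ne_zero
  have h4 : 2 * Real.pi * Complex.I ≠ 0 := by simp [hpi]
  have h5 : ∀ w : ℂ, 2 * Real.pi * Complex.I * (1 / Real.pi * w) = 2 * Complex.I * w := by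
    intro w; field_simp
  refine mul_left_cancel₀ h4 ?_
  simp only [Pi.add_apply, Pi.sub_apply]
  rw [mul_add, mul_inv_cancel_left₀ h4, h5]
  linear_combination -h1 + h2 + h3

theorem tendsto_integral_mul_log_norm {a b : ℝ} (x : ℝ) (hab : a ≤ b) {k : ℝ → ℝ}
    (hk : ContinuousOn k (Icc a b)) :
    Tendsto (fun y : ℝ => ∫ t in a..b, k t * Real.log ‖(x + y * Complex.I - t : ℂ)‖) (𝓝[>] 0)
      (𝓝 (∫ t in a..b, k t * Real.log |x - t|)) := by
  have hlog : IntervalIntegrable (fun t => Real.log (x - t)) volume a b := by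
    have := (intervalIntegral.intervalIntegrable_log' (a := x - a) (b := x - b)).comp_sub_left x
    simpa using this
  have hk' : ContinuousOn k (uIcc a b) := by rwa [uIcc_of_le hab]
  obtain ⟨M, hM⟩ := isCompact_Icc.exists_bound_of_continuousOn hk
  refine intervalIntegral.tendsto_integral_filter_of_dominated_convergence
    (fun t => M * (|Real.log (x - t)| + (|x - t| + 1))) ?_ ?_ ?_ ?_
  · refine Eventually.of_forall fun y => ?_
    refine AEStronglyMeasurable.mul ?_ ?_
    · refine (hk.mono ?_).aestronglyMeasurable measurableSet_uIoc
      rw [uIoc_of_le hab]; exact Ioc_subset_Icc_self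
    · exact Measurable.aestronglyMeasurable (by fun_prop)
  · filter_upwards [Ioo_mem_nhdsGT (show (0 : ℝ) < 1 by norm_num)] with y hy
    have hx : ∀ᵐ t : ℝ, t ≠ x := by simp [ae_iff, measure_singleton]
    filter_upwards [hx] with t ht htm
    rw [uIoc_of_le hab] at htm
    have hM' := hM t (Ioc_subset_Icc_self htm)
    rw [norm_mul]
    refine mul_le_mul hM' ?_ (norm_nonneg _) ((norm_nonneg _).trans hM')
    have hre : |x - t| ≤ ‖(x + y * Complex.I - t : ℂ)‖ := by
      simpa using Complex.abs_re_le_norm (x + y * Complex.I - t : ℂ)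
    have hpos : 0 < |x - t| := abs_pos.2 (sub_ne_zero.2 ht.symm)
    have hle : ‖(x + y * Complex.I - t : ℂ)‖ ≤ |x - t| + y := by
      have h1 : (x + y * Complex.I - t : ℂ) = ((x - t : ℝ) : ℂ) + y * Complex.I := by
        push_cast; ring
      rw [h1]
      refine (norm_add_le _ _).trans ?_
      rw [Complex.norm_real, norm_mul, Complex.norm_real, Complex.norm_I, mul_one,
        Real.norm_eq_abs, Real.norm_eq_abs, abs_of_pos hy.1]
    have hp2 := hpos.trans_le hre
    have h2 := Real.log_le_log hpos hre
    rw [Real.log_abs] at h2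
    have h3 := Real.log_le_sub_one_of_pos hp2
    have h4 := abs_nonneg (Real.log (x - t))
    have h5 := neg_abs_le (Real.log (x - t))
    rw [Real.norm_eq_abs, abs_le]
    have := hy.2
    constructor <;> linarith
  · refine IntervalIntegrable.const_mul (hlog.abs.add ?_) M
    exact Continuous.intervalIntegrable (by fun_prop) _ _
  · have hx : ∀ᵐ t : ℝ, t ≠ x := by simp [ae_iff, measure_singleton]
    filter_upwards [hx] with t ht _
    refine Tendsto.mul tendsto_const_nhds ?_
    have hne : (x + (0 : ℝ) * Complex.I - t : ℂ) ≠ 0 := by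
      have : ((x - t : ℝ) : ℂ) ≠ 0 := by exact_mod_cast sub_ne_zero.2 ht.symm
      simpa using this
    have h1 : ContinuousAt (fun y : ℝ => Real.log ‖(x + y * Complex.I - t : ℂ)‖) 0 :=
      ContinuousAt.log (by fun_prop) (by simpa using hne)
    have h2 : Real.log ‖(x + (0 : ℝ) * Complex.I - t : ℂ)‖ = Real.log |x - t| := by
      have : (x + (0 : ℝ) * Complex.I - t : ℂ) = ((x - t : ℝ) : ℂ) := by push_cast; ring
      rw [this, Complex.norm_real, Real.norm_eq_abs]
    rw [← h2]
    exact h1.tendsto.mono_left nhdsWithin_le_nhds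

theorem hasDerivAt_integral_mul_log_sub {a b : ℝ} (hab : a ≤ b) {k : ℝ → ℝ}
    (hk : ContinuousOn k (Icc a b)) {z : ℂ} (hz : 0 < z.im) :
    HasDerivAt (fun z => ∫ t in a..b, (k t : ℂ) * Complex.log (z - t))
      (∫ t in a..b, (k t : ℂ) * (z - t)⁻¹) z := by
  have hmem : ∀ w : ℂ, 0 < w.im → ∀ t : ℝ, w - t ∈ Complex.slitPlane := fun w hw t =>
    Complex.mem_slitPlane_iff.2 (Or.inr (by simpa using hw.ne'))
  have hd : ∀ w : ℂ, 0 < w.im → ∀ t : ℝ, HasDerivAt (fun z : ℂ => (k t : ℂ) * Complex.log (z - t))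
      ((k t : ℂ) * (w - t)⁻¹) w := fun w hw t => by
    have := (((hasDerivAt_id w).sub_const (t : ℂ)).clog (hmem w hw t)).const_mul (k t : ℂ)
    simpa using this
  have h := hasDerivAt_intervalIntegral_of_continuousOn
    (G := fun z t => (k t : ℂ) * Complex.log (z - t)) (S := {z : ℂ | 0 < z.im})
    (isOpen_lt continuous_const Complex.continuous_im) hab ?_ ?_ hz
  · simpa only [(hd z hz _).deriv] using h
  · have h1 : MapsTo Prod.snd ({z : ℂ | 0 < z.im} ×ˢ Icc a b) (Icc a b) := fun w hw => hw.2
    refine (Complex.continuous_ofReal.comp_continuousOn (hk.comp continuousOn_snd h1)).mul ?_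
    exact ContinuousOn.clog (by fun_prop) fun w hw => hmem w.1 hw.1 w.2
  · exact fun t _ w hw => (hd w hw t).differentiableAt.differentiableWithinAt

theorem exists_analyticAt_eq_add_log_potential {a b d x₀ : ℝ} (ha : a < x₀) (hb : x₀ < b)
    (hd : 0 < d) {f : ℂ → ℂ} {W : ℂ → ℝ} (hc : ContinuousOn f (Icc a b ×ℂ Icc 0 d))
    (hf : ∀ z ∈ Ioo a b ×ℂ Ioo 0 d, DifferentiableAt ℂ f z)
    (hWc : ContinuousOn W (Icc a b ×ℂ Icc 0 d))
    (hW : ∀ z ∈ Ioo a b ×ℂ Ioo 0 d,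
      HasFDerivAt W (Complex.reCLM.comp (f z • (1 : ℂ →L[ℝ] ℂ))) z) :
    ∃ K : ℂ → ℂ, AnalyticAt ℂ K x₀ ∧ ∀ᶠ x : ℝ in 𝓝 x₀,
      W x + (1 / Real.pi) * ∫ t in a..b, (f t).im * Real.log |x - t| = (K x).re := by
  obtain ⟨δ, hδ, hδa, hδb, hδd⟩ : ∃ δ > 0, δ ≤ x₀ - a ∧ δ ≤ b - x₀ ∧ δ ≤ d :=
    ⟨min (x₀ - a) (min (b - x₀) d), by simp [*], by simp, by simp, by simp⟩
  have hab : a ≤ b := by linarith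
  obtain ⟨T, hT, hfT⟩ := exists_eq_cauchy_integral_im_add hδ hδa hδb hδd hc hf
  obtain ⟨P, hP⟩ := hT.isExactOn_ball
  set k : ℝ → ℝ := fun t => (f t).im with hkdef
  have hk : ContinuousOn k (Icc a b) := by
    refine Complex.continuous_im.comp_continuousOn (hc.comp (by fun_prop) fun t ht => ?_)
    simpa [Complex.mem_reProdIm, hd.le] using ht
  set Q : ℂ → ℂ := fun z => ∫ t in a..b, (k t : ℂ) * Complex.log (z - t) with hQdef
  set B : Set ℂ := Metric.ball (x₀ : ℂ) δ ∩ {z | 0 < z.im} with hB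
  have hBo : IsOpen B := Metric.isOpen_ball.inter (isOpen_lt continuous_const Complex.continuous_im)
  have hBc : Convex ℝ B := (convex_ball _ _).inter (convex_halfSpace_im_gt 0)
  have hBR : B ⊆ Ioo a b ×ℂ Ioo 0 d := by
    rintro z ⟨hz1, hz2⟩
    rw [Metric.mem_ball, dist_eq_norm] at hz1
    have h1 := (Complex.abs_re_le_norm _).trans_lt hz1
    have h2 := (Complex.abs_im_le_norm _).trans_lt hz1
    simp only [Complex.sub_re, Complex.ofReal_re, Complex.sub_im, Complex.ofReal_im, sub_zero]
      at h1 h2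
    rw [abs_lt] at h1 h2
    exact ⟨⟨by linarith, by linarith⟩, hz2, by linarith⟩
  set D : ℂ → ℝ := fun z => W z - (P z - (1 / Real.pi) * Q z).re with hD
  have hDd : ∀ z ∈ B, HasFDerivAt D (0 : ℂ →L[ℝ] ℝ) z := by
    intro z hz
    have h1 := (hP z hz.1).sub
      ((hasDerivAt_integral_mul_log_sub hab hk hz.2).const_mul (1 / Real.pi : ℂ))
    have h2 : T z - (1 / Real.pi) * (∫ t in a..b, (k t : ℂ) * (z - t)⁻¹) = f z := by
      have h5 : (∫ t in a..b, ((f t).im : ℂ) * (t - z)⁻¹) =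
          -∫ t in a..b, (k t : ℂ) * (z - t)⁻¹ := by
        simp only [← intervalIntegral.integral_neg, ← mul_neg, ← inv_neg, neg_sub, hkdef]
      rw [hfT z (hBR hz), h5]
      ring
    rw [h2] at h1
    have h3 : HasFDerivAt (fun z => (P z - (1 / Real.pi) * Q z).re)
        (Complex.reCLM.comp (f z • (1 : ℂ →L[ℝ] ℂ))) z := by
      have h4 := h1.hasFDerivAt.restrictScalars ℝ
      refine (HasFDerivAt.comp z (g := Complex.re) Complex.reCLM.hasFDerivAt h4).congr_fderiv ?_
      ext v
      simp [mul_comm]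
    simpa [hD] using! (hW z (hBR hz)).sub h3
  obtain ⟨C, hC⟩ := hBo.exists_is_const_of_fderiv_eq_zero hBc.isPreconnected
    (fun z hz => (hDd z hz).differentiableAt.differentiableWithinAt) (fun z hz => (hDd z hz).fderiv)
  have hPd : DifferentiableOn ℂ P (Metric.ball x₀ δ) := fun z hz =>
    (hP z hz).differentiableAt.differentiableWithinAt
  refine ⟨fun z => P z + C, ?_, ?_⟩
  · exact (hPd.analyticAt (Metric.ball_mem_nhds _ hδ)).add analyticAt_const
  filter_upwards [Metric.ball_mem_nhds x₀ hδ] with x hx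
  have hxb : (x : ℂ) ∈ Metric.ball (x₀ : ℂ) δ := by
    rw [Metric.mem_ball, Complex.dist_eq, ← Complex.ofReal_sub, Complex.norm_real]
    simpa [Real.dist_eq] using hx
  have hcont : Continuous fun y : ℝ => (x + y * Complex.I : ℂ) := by fun_prop
  have hev : ∀ᶠ y : ℝ in 𝓝[>] 0, (x + y * Complex.I : ℂ) ∈ B := by
    have h1 : ∀ᶠ y : ℝ in 𝓝 0, (x + y * Complex.I : ℂ) ∈ Metric.ball (x₀ : ℂ) δ :=
      hcont.continuousAt.eventually (Metric.isOpen_ball.mem_nhds (by simpa using hxb))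
    filter_upwards [nhdsWithin_le_nhds h1, self_mem_nhdsWithin] with y hy hy0
    exact ⟨hy, by simpa using hy0⟩
  have hlim : Tendsto (fun y : ℝ => (x + y * Complex.I : ℂ)) (𝓝[>] 0) (𝓝 x) := by
    have := hcont.tendsto 0
    simp only [Complex.ofReal_zero, zero_mul, add_zero] at this
    exact this.mono_left nhdsWithin_le_nhds
  have hxR : (x : ℂ) ∈ Icc a b ×ℂ Icc 0 d := by
    rw [Metric.mem_ball, Real.dist_eq, abs_lt] at hx
    simp only [Complex.mem_reProdIm, Complex.ofReal_re, Complex.ofReal_im, mem_Icc]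
    refine ⟨⟨?_, ?_⟩, le_rfl, hd.le⟩ <;> linarith
  have l1 : Tendsto (fun y : ℝ => W (x + y * Complex.I)) (𝓝[>] 0) (𝓝 (W x)) := by
    refine (hWc x hxR).tendsto.comp (tendsto_nhdsWithin_iff.2 ⟨hlim, ?_⟩)
    filter_upwards [hev] with y hy
    exact ⟨Ioo_subset_Icc_self (hBR hy).1, Ioo_subset_Icc_self (hBR hy).2⟩
  have l2 : Tendsto (fun y : ℝ => (P (x + y * Complex.I) + C).re) (𝓝[>] 0) (𝓝 (P x + C).re) := by
    have h1 : ContinuousAt P x := (hP x hxb).continuousAt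
    exact (Complex.continuous_re.tendsto _).comp ((h1.tendsto.comp hlim).add tendsto_const_nhds)
  have l3 := (l1.add ((tendsto_integral_mul_log_norm x hab hk).const_mul (1 / Real.pi)))
  refine tendsto_nhds_unique (l3.congr' ?_) l2
  filter_upwards [hev] with y hy
  have h1 := hC _ hy
  have h2 : (Q (x + y * Complex.I)).re =
      ∫ t in a..b, k t * Real.log ‖(x + y * Complex.I - t : ℂ)‖ := by
    have hy0 : 0 < y := by simpa using hy.2
    have hQi : IntervalIntegrable
        (fun t : ℝ => (k t : ℂ) * Complex.log (x + y * Complex.I - t)) volume a b := by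
      refine ContinuousOn.intervalIntegrable_of_Icc hab ?_
      refine (Complex.continuous_ofReal.comp_continuousOn hk).mul
        (ContinuousOn.clog (by fun_prop) fun t _ => ?_)
      exact Complex.mem_slitPlane_iff.2 (Or.inr (by simpa using hy0.ne'))
    have := (Complex.reCLM.intervalIntegral_comp_comm hQi).symm
    simpa [Complex.log_re] using this
  rw [← h2]
  simp only [hD, Complex.sub_re] at h1
  have h3 : ((1 / Real.pi : ℂ) * Q (x + y * Complex.I)).re =
      1 / Real.pi * (Q (x + y * Complex.I)).re := by
    rw [← Complex.re_ofReal_mul]; push_cast; rfl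
  rw [h3] at h1
  simp only [Complex.add_re, Complex.ofReal_re]
  linarith

theorem continuousOn_dslope_prod {F : ℂ → ℂ} {S : Set ℂ} (hS : IsOpen S)
    (hF : DifferentiableOn ℂ F S) :
    ContinuousOn (fun w : ℂ × ℂ => dslope F w.2 w.1) (S ×ˢ S) := by
  rintro ⟨z₀, t₀⟩ ⟨hz, ht⟩
  simp only at hz ht
  refine ContinuousAt.continuousWithinAt ?_
  by_cases h : z₀ = t₀
  · subst h
    have han : AnalyticAt ℂ F z₀ := hF.analyticAt (hS.mem_nhds hz)
    have hstrict := han.hasStrictDerivAt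
    have hcont : ContinuousAt (deriv F) z₀ := han.deriv.continuousAt
    rw [ContinuousAt, Metric.tendsto_nhds]
    intro ε hε
    have h1 := (hasStrictDerivAt_iff_hasStrictFDerivAt.1 hstrict).isLittleO.def (half_pos hε)
    have h2 : ∀ᶠ w : ℂ × ℂ in 𝓝 (z₀, z₀), dist (deriv F w.2) (deriv F z₀) < ε / 2 :=
      (hcont.tendsto.comp (continuous_snd.tendsto (z₀, z₀))).eventually
        (Metric.ball_mem_nhds _ (half_pos hε))
    filter_upwards [h1, h2] with w hw1 hw2
    simp only [dslope_same]
    by_cases hw : w.1 = w.2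
    · rw [hw, dslope_same]; linarith
    · have hne : w.1 - w.2 ≠ 0 := sub_ne_zero.2 hw
      rw [dslope_of_ne _ hw, slope_def_field, dist_eq_norm]
      have h3 : (F w.1 - F w.2) / (w.1 - w.2) - deriv F z₀ =
          (F w.1 - F w.2 - deriv F z₀ * (w.1 - w.2)) / (w.1 - w.2) := by
        field_simp
      have h4 : ‖F w.1 - F w.2 - deriv F z₀ * (w.1 - w.2)‖ ≤ ε / 2 * ‖w.1 - w.2‖ := by
        simpa [mul_comm] using hw1
      rw [h3, norm_div, div_lt_iff₀ (norm_pos_iff.2 hne)]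
      have := norm_pos_iff.2 hne
      nlinarith
  · have h1 : ∀ᶠ w : ℂ × ℂ in 𝓝 (z₀, t₀), w.1 ≠ w.2 :=
      (isOpen_ne_fun continuous_fst continuous_snd).mem_nhds h
    have h2 : ContinuousAt (fun w : ℂ × ℂ => (F w.1 - F w.2) / (w.1 - w.2)) (z₀, t₀) := by
      have e1 : ContinuousAt F z₀ := (hF.differentiableAt (hS.mem_nhds hz)).continuousAt
      have e2 : ContinuousAt F t₀ := (hF.differentiableAt (hS.mem_nhds ht)).continuousAt
      refine ContinuousAt.div ?_ (by fun_prop) (sub_ne_zero.2 h)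
      exact (ContinuousAt.comp (f := Prod.fst) e1 continuousAt_fst).sub
        (ContinuousAt.comp (f := Prod.snd) e2 continuousAt_snd)
    refine h2.congr ?_
    filter_upwards [h1] with w hw
    rw [dslope_of_ne _ hw, slope_def_field]

theorem exists_analyticAt_integral_mul_log_norm {p q x₀ ρ : ℝ} (hpq : p ≤ q) (hρ : 0 < ρ)
    {k : ℝ → ℝ} (hk : ContinuousOn k (Icc p q)) {m : ℂ → ℝ → ℂ}
    (hm : ContinuousOn (fun w : ℂ × ℝ => m w.1 w.2) (Metric.ball (x₀ : ℂ) ρ ×ˢ Icc p q))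
    (hd : ∀ t ∈ Icc p q, DifferentiableOn ℂ (fun z => m z t) (Metric.ball x₀ ρ))
    (h0 : ∀ t ∈ Icc p q, m x₀ t ∈ Complex.slitPlane) :
    ∃ K : ℂ → ℂ, AnalyticAt ℂ K x₀ ∧ ∀ᶠ x : ℝ in 𝓝 x₀,
      IntervalIntegrable (fun t => k t * (1 / 2 * Real.log ‖m x t‖)) volume p q ∧
      ∫ t in p..q, k t * (1 / 2 * Real.log ‖m x t‖) = (K x).re := by
  have h1 : ∀ᶠ z in 𝓝 (x₀ : ℂ), ∀ t ∈ Icc p q, t ∈ Icc p q → m z t ∈ Complex.slitPlane := by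
    refine isCompact_Icc.eventually_forall_of_forall_eventually fun t ht => ?_
    have h2 := (hm (x₀, t) ⟨Metric.mem_ball_self hρ, ht⟩).eventually
      (Complex.isOpen_slitPlane.mem_nhds (h0 t ht))
    rw [eventually_nhdsWithin_iff] at h2
    have h3 : ∀ᶠ w : ℂ × ℝ in 𝓝 ((x₀ : ℂ), t), w.1 ∈ Metric.ball (x₀ : ℂ) ρ :=
      (continuous_fst.tendsto _).eventually (Metric.ball_mem_nhds _ hρ)
    filter_upwards [h2, h3] with w hw2 hw3 hwt using hw2 ⟨hw3, hwt⟩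
  obtain ⟨r, hr, hrs⟩ := Metric.eventually_nhds_iff_ball.1 (h1.and (Metric.ball_mem_nhds _ hρ))
  have hsub : Metric.ball (x₀ : ℂ) r ⊆ Metric.ball x₀ ρ := fun z hz => (hrs z hz).2
  have hmem : ∀ z ∈ Metric.ball (x₀ : ℂ) r, ∀ t ∈ Icc p q, m z t ∈ Complex.slitPlane :=
    fun z hz t ht => (hrs z hz).1 t ht ht
  have hkc : ContinuousOn (fun t => (k t : ℂ)) (Icc p q) :=
    Complex.continuous_ofReal.comp_continuousOn hk
  have hG : ContinuousOn (fun w : ℂ × ℝ => (k w.2 : ℂ) * (1 / 2 * Complex.log (m w.1 w.2)))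
      (Metric.ball (x₀ : ℂ) r ×ˢ Icc p q) := by
    have e1 : MapsTo Prod.snd (Metric.ball (x₀ : ℂ) r ×ˢ Icc p q) (Icc p q) := fun w hw => hw.2
    refine (hkc.comp continuousOn_snd e1).mul (continuousOn_const.mul ?_)
    exact (hm.mono (prod_mono hsub Subset.rfl)).clog fun w hw => hmem w.1 hw.1 w.2 hw.2
  have hGd : ∀ t ∈ Icc p q, DifferentiableOn ℂ
      (fun z => (k t : ℂ) * (1 / 2 * Complex.log (m z t))) (Metric.ball (x₀ : ℂ) r) := fun t ht =>
    ((((hd t ht).mono hsub).clog fun z hz => hmem z hz t ht).const_mul _).const_mul _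
  refine ⟨fun z => ∫ t in p..q, (k t : ℂ) * (1 / 2 * Complex.log (m z t)), ?_, ?_⟩
  · refine DifferentiableOn.analyticAt (s := Metric.ball (x₀ : ℂ) r) (fun z hz => ?_)
      (Metric.ball_mem_nhds _ hr)
    exact (hasDerivAt_intervalIntegral_of_continuousOn (G := fun z t => (k t : ℂ) *
      (1 / 2 * Complex.log (m z t))) Metric.isOpen_ball hpq hG hGd
        hz).differentiableAt.differentiableWithinAt
  · filter_upwards [Metric.ball_mem_nhds x₀ hr] with x hx
    have hxb : (x : ℂ) ∈ Metric.ball (x₀ : ℂ) r := by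
      rw [Metric.mem_ball, Complex.dist_eq, ← Complex.ofReal_sub, Complex.norm_real]
      simpa [Real.dist_eq] using hx
    have hint : IntervalIntegrable (fun t => (k t : ℂ) * (1 / 2 * Complex.log (m x t)))
        volume p q := by
      refine ContinuousOn.intervalIntegrable_of_Icc hpq ?_
      exact hG.comp (f := fun t : ℝ => ((x : ℂ), t)) (by fun_prop) fun t ht => ⟨hxb, ht⟩
    have hre : ∀ t, ((k t : ℂ) * (1 / 2 * Complex.log (m x t))).re =
        k t * (1 / 2 * Real.log ‖m x t‖) := fun t => by
      rw [Complex.re_ofReal_mul, show (1 / 2 : ℂ) = ((1 / 2 : ℝ) : ℂ) by push_cast; rfl,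
        Complex.re_ofReal_mul, Complex.log_re]
    have e1 := Complex.reCLM.intervalIntegral_comp_comm hint
    simp only [Complex.reCLM_apply, hre] at e1
    refine ⟨?_, e1⟩
    have e2 : IntervalIntegrable
      (fun t => ((k t : ℂ) * (1 / 2 * Complex.log (m x t))).re) volume p q :=
      ⟨hint.1.re, hint.2.re⟩
    simpa only [hre] using e2

theorem deriv_eq_ofReal_deriv {F : ℂ → ℂ} {ψ : ℝ → ℝ} {x : ℝ} (hF : DifferentiableAt ℂ F x)
    (hψ : DifferentiableAt ℝ ψ x) (h : ∀ᶠ y : ℝ in 𝓝 x, F y = ψ y) :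
    deriv F x = ((deriv ψ x : ℝ) : ℂ) :=
  (hF.hasDerivAt.comp_ofReal).unique (hψ.hasDerivAt.ofReal_comp.congr_of_eventuallyEq h)

theorem log_sqrt_sq_add_sq_eq {s w : ℝ} (hs : s ≠ 0) :
    Real.log √(s ^ 2 + w ^ 2) = Real.log |s| + 1 / 2 * Real.log (1 + (w / s) ^ 2) := by
  have h1 : s ^ 2 + w ^ 2 = s ^ 2 * (1 + (w / s) ^ 2) := by field_simp
  have h2 : 0 < s ^ 2 := by positivity
  rw [Real.log_sqrt (by positivity), h1, Real.log_mul h2.ne' (by positivity), Real.log_pow,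
    Real.log_abs]
  push_cast; ring

theorem exists_analyticAt_integral_log_near {a b x₀ ρ : ℝ} (hab : a ≤ b) (hρ : 0 < ρ)
    {F : ℂ → ℂ} (hF : DifferentiableOn ℂ F (Metric.ball x₀ ρ)) {ψ k : ℝ → ℝ}
    (hsub : Icc a b ⊆ Metric.ball x₀ ρ) (hψ : DifferentiableOn ℝ ψ (Metric.ball x₀ ρ))
    (hFψ : ∀ x ∈ Metric.ball x₀ ρ, F x = ψ x) (hk : ContinuousOn k (Icc a b)) :
    ∃ K : ℂ → ℂ, AnalyticAt ℂ K x₀ ∧ ∀ᶠ x : ℝ in 𝓝 x₀,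
      IntervalIntegrable (fun t => k t * Real.log √((x - t) ^ 2 + (ψ x - ψ t) ^ 2)) volume a b ∧
      ∫ t in a..b, k t * Real.log √((x - t) ^ 2 + (ψ x - ψ t) ^ 2) =
        (∫ t in a..b, k t * Real.log |x - t|) + (K x).re := by
  have hball : ∀ x ∈ Metric.ball x₀ ρ, (x : ℂ) ∈ Metric.ball (x₀ : ℂ) ρ := fun x hx => by
    rw [Metric.mem_ball, Complex.dist_eq, ← Complex.ofReal_sub, Complex.norm_real]
    simpa [Real.dist_eq] using hx
  have hq : ∀ x ∈ Metric.ball x₀ ρ, ∀ t ∈ Metric.ball x₀ ρ,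
      dslope F t x = (dslope ψ t x : ℝ) := by
    intro x hx t ht
    by_cases h : x = t
    · subst h
      rw [dslope_same, dslope_same]
      refine deriv_eq_ofReal_deriv
        (hF.differentiableAt (Metric.isOpen_ball.mem_nhds (hball x hx)))
        (hψ.differentiableAt (Metric.isOpen_ball.mem_nhds hx)) ?_
      filter_upwards [Metric.isOpen_ball.mem_nhds hx] with y hy using hFψ y hy
    · rw [dslope_of_ne _ h, dslope_of_ne _ (by exact_mod_cast h), slope_def_field, slope_def_field,
        hFψ x hx, hFψ t ht]
      push_cast; rfl
  have hone : ∀ s : ℝ, (1 + (s : ℂ) ^ 2) = ((1 + s ^ 2 : ℝ) : ℂ) := fun s => by push_cast; rfl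
  have hm : ContinuousOn (fun w : ℂ × ℝ => 1 + dslope F w.2 w.1 ^ 2)
      (Metric.ball (x₀ : ℂ) ρ ×ˢ Icc a b) := by
    refine continuousOn_const.add (ContinuousOn.pow ?_ 2)
    refine (continuousOn_dslope_prod Metric.isOpen_ball hF).comp
      (f := fun w : ℂ × ℝ => (w.1, (w.2 : ℂ))) (by fun_prop) fun w hw => ?_
    exact ⟨hw.1, hball _ (hsub hw.2)⟩
  have hd : ∀ t ∈ Icc a b, DifferentiableOn ℂ (fun z => 1 + dslope F t z ^ 2)
      (Metric.ball x₀ ρ) := by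
    intro t ht
    refine (differentiableOn_const _).add (DifferentiableOn.pow ?_ 2)
    exact (Complex.differentiableOn_dslope
      (Metric.isOpen_ball.mem_nhds (hball _ (hsub ht)))).2 hF
  have h0 : ∀ t ∈ Icc a b, 1 + dslope F t x₀ ^ 2 ∈ Complex.slitPlane := by
    intro t ht
    rw [hq x₀ (Metric.mem_ball_self hρ) t (hsub ht), hone, Complex.ofReal_mem_slitPlane]
    positivity
  obtain ⟨K, hK, hKx⟩ := exists_analyticAt_integral_mul_log_norm (x₀ := x₀)
    (m := fun z t => 1 + dslope F t z ^ 2) hab hρ hk hm hd h0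
  refine ⟨K, hK, ?_⟩
  filter_upwards [hKx, Metric.ball_mem_nhds x₀ hρ] with x hx hxb
  have hlog : IntervalIntegrable (fun t => k t * Real.log |x - t|) volume a b := by
    have := (intervalIntegral.intervalIntegrable_log' (a := x - a) (b := x - b)).comp_sub_left x
    refine IntervalIntegrable.continuousOn_mul (by simpa using this) ?_
    rwa [uIcc_of_le hab]
  have hae : ∀ᵐ t : ℝ, t ∈ Set.uIoc a b → k t * Real.log |x - t| +
      k t * (1 / 2 * Real.log ‖1 + dslope F t x ^ 2‖) =
      k t * Real.log √((x - t) ^ 2 + (ψ x - ψ t) ^ 2) := by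
    have hx : ∀ᵐ t : ℝ, t ≠ x := by simp [ae_iff, measure_singleton]
    filter_upwards [hx] with t ht htm
    rw [uIoc_of_le hab] at htm
    have htb := hsub (Ioc_subset_Icc_self htm)
    rw [log_sqrt_sq_add_sq_eq (sub_ne_zero.2 ht.symm), hq x hxb t htb, hone,
      Complex.norm_real, Real.norm_of_nonneg (by positivity), dslope_of_ne _ ht.symm,
      slope_def_field]
    ring
  refine ⟨(hlog.add hx.1).congr_ae ?_, ?_⟩
  · exact (ae_restrict_iff' measurableSet_uIoc).2 hae
  · rw [← hx.2, ← intervalIntegral.integral_add hlog hx.1]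
    exact (intervalIntegral.integral_congr_ae hae).symm

theorem exists_analyticAt_integral_log_away {p q x₀ : ℝ} (hpq : p ≤ q) (hx₀ : x₀ ∉ Icc p q)
    {F : ℂ → ℂ} (hF : AnalyticAt ℂ F x₀) {ψ k : ℝ → ℝ} (hFψ : ∀ᶠ x : ℝ in 𝓝 x₀, F x = ψ x)
    (hψ : ContinuousOn ψ (Icc p q)) (hk : ContinuousOn k (Icc p q)) :
    ∃ K : ℂ → ℂ, AnalyticAt ℂ K x₀ ∧ ∀ᶠ x : ℝ in 𝓝 x₀,
      IntervalIntegrable (fun t => k t * Real.log √((x - t) ^ 2 + (ψ x - ψ t) ^ 2)) volume p q ∧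
      ∫ t in p..q, k t * Real.log √((x - t) ^ 2 + (ψ x - ψ t) ^ 2) = (K x).re := by
  obtain ⟨ρ, hρ, hρF⟩ := Metric.eventually_nhds_iff_ball.1 hF.eventually_analyticAt
  have hFd : DifferentiableOn ℂ F (Metric.ball x₀ ρ) := fun z hz =>
    (hρF z hz).differentiableAt.differentiableWithinAt
  have hreal : ∀ x : ℝ, F x = ψ x → ∀ t : ℝ, ((x : ℂ) - t) ^ 2 + (F x - ψ t) ^ 2 =
      (((x - t) ^ 2 + (ψ x - ψ t) ^ 2 : ℝ) : ℂ) := fun x hx t => by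
    rw [hx]; push_cast; rfl
  have hm : ContinuousOn (fun w : ℂ × ℝ => (w.1 - w.2) ^ 2 + (F w.1 - ψ w.2) ^ 2)
      (Metric.ball (x₀ : ℂ) ρ ×ˢ Icc p q) := by
    have e1 : MapsTo Prod.snd (Metric.ball (x₀ : ℂ) ρ ×ˢ Icc p q) (Icc p q) := fun w hw => hw.2
    have e2 : MapsTo Prod.fst (Metric.ball (x₀ : ℂ) ρ ×ˢ Icc p q) (Metric.ball (x₀ : ℂ) ρ) :=
      fun w hw => hw.1
    refine ContinuousOn.add (by fun_prop) (ContinuousOn.pow ?_ 2)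
    exact (hFd.continuousOn.comp continuousOn_fst e2).sub
      (Complex.continuous_ofReal.comp_continuousOn (hψ.comp continuousOn_snd e1))
  have hd : ∀ t ∈ Icc p q, DifferentiableOn ℂ (fun z => (z - t) ^ 2 + (F z - ψ t) ^ 2)
      (Metric.ball x₀ ρ) := by
    intro t ht
    exact DifferentiableOn.add (by fun_prop) ((hFd.sub_const _).pow 2)
  have h0 : ∀ t ∈ Icc p q, ((x₀ : ℂ) - t) ^ 2 + (F x₀ - ψ t) ^ 2 ∈ Complex.slitPlane := by
    intro t ht
    rw [hreal x₀ hFψ.self_of_nhds, Complex.ofReal_mem_slitPlane]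
    have : x₀ - t ≠ 0 := sub_ne_zero.2 fun h => hx₀ (h ▸ ht)
    positivity
  obtain ⟨K, hK, hKx⟩ := exists_analyticAt_integral_mul_log_norm (x₀ := x₀)
    (m := fun z t => (z - t) ^ 2 + (F z - ψ t) ^ 2) hpq hρ hk hm hd h0
  refine ⟨K, hK, ?_⟩
  filter_upwards [hKx, hFψ] with x hx hxF
  have e : ∀ t : ℝ, Real.log √((x - t) ^ 2 + (ψ x - ψ t) ^ 2) =
      1 / 2 * Real.log ‖((x : ℂ) - t) ^ 2 + (F x - ψ t) ^ 2‖ := fun t => by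
    rw [hreal x hxF, Complex.norm_real, Real.norm_of_nonneg (by positivity),
      Real.log_sqrt (by positivity)]
    ring
  simpa only [e] using hx

theorem pdx_eq_fderiv {u : ℝ × ℝ → ℝ} {p : ℝ × ℝ} (hu : DifferentiableAt ℝ u p) :
    pdx u p = fderiv ℝ u p (1, 0) := by
  have h : HasDerivAt (fun x : ℝ => (x, p.2)) ((1 : ℝ), (0 : ℝ)) p.1 :=
    (hasDerivAt_id p.1).prodMk (hasDerivAt_const _ _)
  exact (HasFDerivAt.comp_hasDerivAt (f := fun x : ℝ => (x, p.2)) p.1 hu.hasFDerivAt h).deriv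

theorem pdy_eq_fderiv {u : ℝ × ℝ → ℝ} {p : ℝ × ℝ} (hu : DifferentiableAt ℝ u p) :
    pdy u p = fderiv ℝ u p (0, 1) := by
  have h : HasDerivAt (fun y : ℝ => (p.1, y)) ((0 : ℝ), (1 : ℝ)) p.2 :=
    (hasDerivAt_const _ _).prodMk (hasDerivAt_id p.2)
  exact (HasFDerivAt.comp_hasDerivAt (f := fun y : ℝ => (p.1, y)) p.2 hu.hasFDerivAt h).deriv

theorem lap_eq_fderiv_fderiv {u : ℝ × ℝ → ℝ} {p : ℝ × ℝ} (hu : ContDiffAt ℝ 2 u p) :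
    lap u p = fderiv ℝ (fderiv ℝ u) p (1, 0) (1, 0) + fderiv ℝ (fderiv ℝ u) p (0, 1) (0, 1) := by
  have hev : ∀ᶠ q in 𝓝 p, DifferentiableAt ℝ u q :=
    (hu.eventually (by simp)).mono fun q hq => hq.differentiableAt (by simp)
  have hD : DifferentiableAt ℝ (fderiv ℝ u) p :=
    (hu.fderiv_right (m := 1) (by norm_num)).differentiableAt (by simp)
  have e1 : pdx u =ᶠ[𝓝 p] fun q => fderiv ℝ u q (1, 0) := hev.mono fun q hq => pdx_eq_fderiv hq
  have e2 : pdy u =ᶠ[𝓝 p] fun q => fderiv ℝ u q (0, 1) := hev.mono fun q hq => pdy_eq_fderiv hq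
  have h1 := hD.hasFDerivAt.clm_apply (hasFDerivAt_const ((1 : ℝ), (0 : ℝ)) p)
  have h2 := hD.hasFDerivAt.clm_apply (hasFDerivAt_const ((0 : ℝ), (1 : ℝ)) p)
  have h3 := h1.congr_of_eventuallyEq e1
  have h4 := h2.congr_of_eventuallyEq e2
  rw [lap, pdx_eq_fderiv h3.differentiableAt, pdy_eq_fderiv h4.differentiableAt, h3.fderiv,
    h4.fderiv]
  simp

theorem differentiableAt_complex_gradient {u : ℝ × ℝ → ℝ} {z : ℂ}
    (hu : ContDiffAt ℝ 2 u (z.re, z.im)) (hl : lap u (z.re, z.im) = 0) :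
    DifferentiableAt ℂ (fun z : ℂ => ((fderiv ℝ u (z.re, z.im) (1, 0) : ℝ) : ℂ) -
      Complex.I * ((fderiv ℝ u (z.re, z.im) (0, 1) : ℝ) : ℂ)) z := by
  have hD : DifferentiableAt ℝ (fderiv ℝ u) (z.re, z.im) :=
    (hu.fderiv_right (m := 1) (by norm_num)).differentiableAt (by simp)
  have hsymm := hu.isSymmSndFDerivAt (by simp) ((1 : ℝ), (0 : ℝ)) ((0 : ℝ), (1 : ℝ))
  rw [lap_eq_fderiv_fderiv hu] at hl
  have hG : HasFDerivAt (fun z : ℂ => (z.re, z.im)) (Complex.reCLM.prod Complex.imCLM) z :=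
    (Complex.reCLM.prod Complex.imCLM).hasFDerivAt
  have hc := HasFDerivAt.comp (f := fun z : ℂ => (z.re, z.im)) z hD.hasFDerivAt hG
  have h1 := Complex.ofRealCLM.hasFDerivAt.comp z
    (hc.clm_apply (hasFDerivAt_const ((1 : ℝ), (0 : ℝ)) z))
  have h2 := Complex.ofRealCLM.hasFDerivAt.comp z
    (hc.clm_apply (hasFDerivAt_const ((0 : ℝ), (1 : ℝ)) z))
  have h3 := h1.sub (h2.const_mul Complex.I)
  have h4 : HasFDerivAt (fun z : ℂ => ((fderiv ℝ u (z.re, z.im) (1, 0) : ℝ) : ℂ) -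
      Complex.I * ((fderiv ℝ u (z.re, z.im) (0, 1) : ℝ) : ℂ)) _ z := h3
  rw [differentiableAt_complex_iff_differentiableAt_real]
  refine ⟨h4.differentiableAt, ?_⟩
  rw [h4.fderiv]
  apply Complex.ext <;> simp <;> linarith

theorem hasFDerivAt_comp_re_im {u : ℝ × ℝ → ℝ} {L : ℝ × ℝ →L[ℝ] ℝ} {φ : ℂ → ℂ} {φ' z : ℂ}
    (hu : HasFDerivAt u L ((φ z).re, (φ z).im)) (hφ : HasDerivAt φ φ' z) :
    HasFDerivAt (fun z => u ((φ z).re, (φ z).im)) (Complex.reCLM.comp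
      ((((L (1, 0) : ℝ) - Complex.I * (L (0, 1) : ℝ)) * φ') • (1 : ℂ →L[ℝ] ℂ))) z := by
  have hG : HasFDerivAt (fun z : ℂ => (z.re, z.im)) (Complex.reCLM.prod Complex.imCLM) (φ z) :=
    (Complex.reCLM.prod Complex.imCLM).hasFDerivAt
  have h1 : HasFDerivAt (fun z => u ((φ z).re, (φ z).im)) _ z :=
    (HasFDerivAt.comp (f := fun z : ℂ => (z.re, z.im)) (φ z) hu hG).comp z
      hφ.complexToReal_fderiv
  refine h1.congr_fderiv ?_
  ext w
  have h2 : ∀ s t : ℝ, L (s, t) = s * L (1, 0) + t * L (0, 1) := fun s t => by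
    have h3 : (s, t) = s • ((1 : ℝ), (0 : ℝ)) + t • ((0 : ℝ), (1 : ℝ)) := by simp
    rw [h3, map_add, map_smul, map_smul, smul_eq_mul, smul_eq_mul]
  simp
  rw [h2 (_ - _)]
  ring

theorem eventually_graph_lt_im {F : ℂ → ℂ} {ψ : ℝ → ℝ} {x₀ : ℝ} (hF : AnalyticAt ℂ F x₀)
    (hψ : AnalyticAt ℝ ψ x₀) (hFψ : ∀ᶠ x : ℝ in 𝓝 x₀, F x = ψ x) :
    ∀ᶠ z in 𝓝 (x₀ : ℂ), 0 < z.im →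
      ψ (z + Complex.I * F z).re < (z + Complex.I * F z).im := by
  have hre : ((x₀ : ℂ) + Complex.I * F x₀).re = x₀ := by simp [hFψ.self_of_nhds]
  have hd := deriv_eq_ofReal_deriv hF.differentiableAt hψ.differentiableAt hFψ
  have h1 := ((hasStrictDerivAt_id (x₀ : ℂ)).add
    (hF.hasStrictDerivAt.const_mul Complex.I)).complexToReal_fderiv
  have h2 := Complex.reCLM.hasStrictFDerivAt.comp (x₀ : ℂ) h1
  have h3 := Complex.imCLM.hasStrictFDerivAt.comp (x₀ : ℂ) h1
  have h5 := hψ.hasStrictDerivAt.hasStrictFDerivAt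
  rw [← hre] at h5
  have h6 := (h3.sub (HasStrictFDerivAt.comp (x₀ : ℂ) h5 h2)).isLittleO.def
    (half_pos one_pos)
  have h7 : Tendsto (fun z : ℂ => (z, (z.re : ℂ))) (𝓝 (x₀ : ℂ)) (𝓝 ((x₀ : ℂ), (x₀ : ℂ))) := by
    have : Continuous fun z : ℂ => (z, (z.re : ℂ)) := by fun_prop
    simpa using this.tendsto (x₀ : ℂ)
  have h8 : ∀ᶠ z in 𝓝 (x₀ : ℂ), F (z.re : ℝ) = ψ z.re := by
    have := Complex.continuous_re.tendsto (x₀ : ℂ)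
    rw [Complex.ofReal_re] at this
    exact this.eventually hFψ
  filter_upwards [h7.eventually h6, h8] with z hz hzF hpos
  have h9 : z - z.re = z.im * Complex.I := by
    apply Complex.ext <;> simp
  simp only [h9, hd] at hz
  have h10 : ‖(z.im : ℂ) * Complex.I‖ = z.im := by
    simp [abs_of_pos hpos]
  rw [h10, Real.norm_eq_abs, abs_le] at hz
  have h11 := hz.1
  simp [hzF, hFψ.self_of_nhds] at h11
  have h12 : 0 ≤ deriv ψ x₀ * z.im * deriv ψ x₀ := by
    rw [mul_right_comm]; exact mul_nonneg (mul_self_nonneg _) hpos.le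
  simp only [Complex.add_re, Complex.add_im, Complex.I_mul_re, Complex.I_mul_im]
  linarith

theorem notMem_closure_subgraph {ψ : ℝ → ℝ} {s : Set ℝ} (hs : IsOpen s) (hψ : ContinuousOn ψ s)
    {p : ℝ × ℝ} (h1 : p.1 ∈ s) (h2 : ψ p.1 < p.2) :
    p ∉ closure {p : ℝ × ℝ | p.1 ∈ s ∧ p.2 < ψ p.1} := by
  rw [mem_closure_iff_frequently, Filter.not_frequently]
  have h3 : ContinuousAt (fun q : ℝ × ℝ => ψ q.1) p :=
    ContinuousAt.comp (f := Prod.fst) (hψ.continuousAt (hs.mem_nhds h1)) continuousAt_fst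
  filter_upwards [h3.eventually_lt continuousAt_snd h2] with q hq hq'
  exact lt_asymm hq hq'.2

theorem exists_analyticAt_add_log_potential_of_laplace {s : Set ℝ} (hs : IsOpen s) {ψ : ℝ → ℝ}
    (hψ : AnalyticOnNhd ℝ ψ s) {x₀ ρ : ℝ} (hx₀ : x₀ ∈ s) (hρ : 0 < ρ) {F : ℂ → ℂ}
    (hF : AnalyticOnNhd ℂ F (Metric.ball x₀ ρ)) (hFψ : ∀ x ∈ Metric.ball x₀ ρ, F x = ψ x)
    {Ω U : Set (ℝ × ℝ)} (hΩ : Ω = {p : ℝ × ℝ | p.1 ∈ s ∧ p.2 < ψ p.1}) (hU : IsOpen U)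
    (hxU : (x₀, ψ x₀) ∈ U) {u : ℝ × ℝ → ℝ} {u' : ℝ × ℝ → ℝ × ℝ →L[ℝ] ℝ}
    (hu : ContDiffOn ℝ 2 u (U \ closure Ω))
    (hu' : ∀ p ∈ U \ Ω, HasFDerivWithinAt u (u' p) (U \ Ω) p) (hu'c : ContinuousOn u' (U \ Ω))
    (hl : ∀ p ∈ U \ closure Ω, lap u p = 0) :
    ∃ a b : ℝ, a < x₀ ∧ x₀ < b ∧ Icc a b ⊆ Metric.ball x₀ ρ ∧ ∃ K : ℂ → ℂ, AnalyticAt ℂ K x₀ ∧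
      ∀ᶠ x : ℝ in 𝓝 x₀, u (x, ψ x) - (1 / Real.pi) *
        ∫ t in a..b, u' (t, ψ t) (-(deriv ψ t), 1) * Real.log |x - t| = (K x).re := by
  have hball : ∀ x ∈ Metric.ball x₀ ρ, (x : ℂ) ∈ Metric.ball (x₀ : ℂ) ρ := fun x hx => by
    rw [Metric.mem_ball, Complex.dist_eq, ← Complex.ofReal_sub, Complex.norm_real]
    simpa [Real.dist_eq] using hx
  have hFx : AnalyticAt ℂ F x₀ := hF _ (Metric.mem_ball_self hρ)
  have hFe : ∀ᶠ x : ℝ in 𝓝 x₀, F x = ψ x :=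
    Filter.mem_of_superset (Metric.ball_mem_nhds x₀ hρ) hFψ
  set φ : ℂ → ℂ := fun z => z + Complex.I * F z with hφ
  set P : ℂ → ℝ × ℝ := fun z => ((φ z).re, (φ z).im) with hP
  have hφr : ∀ x ∈ Metric.ball x₀ ρ, P x = (x, ψ x) := fun x hx => by
    simp [hP, hφ, hFψ x hx]
  have hφd : ∀ z ∈ Metric.ball (x₀ : ℂ) ρ, HasDerivAt φ (1 + Complex.I * deriv F z) z :=
    fun z hz => (hasDerivAt_id z).add ((hF z hz).differentiableAt.hasDerivAt.const_mul _)
  have hPc : ∀ z ∈ Metric.ball (x₀ : ℂ) ρ, ContinuousAt P z := fun z hz =>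
    (Complex.continuous_re.continuousAt.comp (hφd z hz).continuousAt).prodMk
      (Complex.continuous_im.continuousAt.comp (hφd z hz).continuousAt)
  have hx₀c : (x₀ : ℂ) ∈ Metric.ball (x₀ : ℂ) ρ := Metric.mem_ball_self hρ
  have hxr : P x₀ = (x₀, ψ x₀) := hφr x₀ (Metric.mem_ball_self hρ)
  have hev1 : ∀ᶠ z in 𝓝 (x₀ : ℂ), P z ∈ U :=
    (hPc _ hx₀c).eventually (by rw [hxr]; exact hU.mem_nhds hxU)
  have hev2 : ∀ᶠ z in 𝓝 (x₀ : ℂ), (P z).1 ∈ s :=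
    (continuousAt_fst.comp (hPc _ hx₀c)).eventually (by
      simp only [Function.comp, hxr]; exact hs.mem_nhds hx₀)
  obtain ⟨r, hr, hball_r⟩ := Metric.eventually_nhds_iff_ball.1
    ((eventually_graph_lt_im hFx (hψ x₀ hx₀) hFe).and
      (hev1.and (hev2.and (Metric.ball_mem_nhds (x₀ : ℂ) hρ))))
  have hrect : Icc (x₀ - r / 3) (x₀ + r / 3) ×ℂ Icc 0 (r / 3) ⊆ Metric.ball (x₀ : ℂ) r := by
    rintro z ⟨⟨hz1, hz2⟩, hz3, hz4⟩
    rw [Metric.mem_ball, Complex.dist_eq]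
    refine (Complex.norm_le_abs_re_add_abs_im _).trans_lt ?_
    have e1 : |(z - x₀).re| ≤ r / 3 := by
      rw [abs_le]; simp only [Complex.sub_re, Complex.ofReal_re]; constructor <;> linarith
    have e2 : |(z - x₀).im| ≤ r / 3 := by
      rw [abs_le]; simp only [Complex.sub_im, Complex.ofReal_im]; constructor <;> linarith
    linarith
  have hIcc : ∀ x ∈ Icc (x₀ - r / 3) (x₀ + r / 3),
      (x : ℂ) ∈ Icc (x₀ - r / 3) (x₀ + r / 3) ×ℂ Icc 0 (r / 3) := fun x hx =>
    ⟨by simpa using hx, by simpa using by positivity⟩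
  have hsub : Icc (x₀ - r / 3) (x₀ + r / 3) ⊆ Metric.ball x₀ ρ := fun x hx => by
    have := (hball_r _ (hrect (hIcc x hx))).2.2.2
    rw [Complex.dist_eq, ← Complex.ofReal_sub, Complex.norm_real] at this
    simpa [Real.dist_eq] using this
  have hmap : ∀ z ∈ Icc (x₀ - r / 3) (x₀ + r / 3) ×ℂ Icc 0 (r / 3), P z ∈ U \ Ω := by
    intro z hz
    obtain ⟨g1, g2, g3, g4⟩ := hball_r z (hrect hz)
    refine ⟨g2, fun hz' => ?_⟩
    rw [hΩ] at hz'
    rcases hz.2.1.lt_or_eq with hpos | hzero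
    · exact lt_asymm (g1 hpos) hz'.2
    · have hzr : (z.re : ℂ) = z := by
        apply Complex.ext <;> simp [← hzero]
      have := hz'.2
      rw [← hzr, hφr _ (hsub hz.1)] at this
      exact lt_irrefl _ this
  have hO : IsOpen (U \ closure Ω) := hU.sdiff isClosed_closure
  have hOsub : U \ closure Ω ⊆ U \ Ω := sdiff_subset_sdiff_right subset_closure
  have hmapO : ∀ z ∈ Ioo (x₀ - r / 3) (x₀ + r / 3) ×ℂ Ioo 0 (r / 3), P z ∈ U \ closure Ω := by
    intro z hz
    obtain ⟨g1, g2, g3, g4⟩ := hball_r z (hrect ⟨Ioo_subset_Icc_self hz.1,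
      Ioo_subset_Icc_self hz.2⟩)
    refine ⟨g2, ?_⟩
    rw [hΩ]
    exact notMem_closure_subgraph hs hψ.continuousOn g3 (g1 hz.2.1)
  have hfd : ∀ p ∈ U \ closure Ω, HasFDerivAt u (u' p) p := fun p hp =>
    ((hu' p (hOsub hp)).mono hOsub).hasFDerivAt (hO.mem_nhds hp)
  have hball_rect : ∀ z ∈ Icc (x₀ - r / 3) (x₀ + r / 3) ×ℂ Icc 0 (r / 3),
      z ∈ Metric.ball (x₀ : ℂ) ρ := fun z hz => (hball_r z (hrect hz)).2.2.2
  have hPcont : ContinuousOn P (Icc (x₀ - r / 3) (x₀ + r / 3) ×ℂ Icc 0 (r / 3)) := fun z hz =>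
    (hPc z (hball_rect z hz)).continuousWithinAt
  have hIoo : Ioo (x₀ - r / 3) (x₀ + r / 3) ×ℂ Ioo 0 (r / 3) ⊆
      Icc (x₀ - r / 3) (x₀ + r / 3) ×ℂ Icc 0 (r / 3) := fun z hz =>
    ⟨Ioo_subset_Icc_self hz.1, Ioo_subset_Icc_self hz.2⟩
  set f : ℂ → ℂ := fun z => (((u' (P z) (1, 0) : ℝ) : ℂ) -
    Complex.I * ((u' (P z) (0, 1) : ℝ) : ℂ)) * (1 + Complex.I * deriv F z) with hf
  have hfc : ContinuousOn f (Icc (x₀ - r / 3) (x₀ + r / 3) ×ℂ Icc 0 (r / 3)) := by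
    have e1 := hu'c.comp hPcont hmap
    have e2 : ContinuousOn (deriv F) (Icc (x₀ - r / 3) (x₀ + r / 3) ×ℂ Icc 0 (r / 3)) :=
      fun z hz => (hF z (hball_rect z hz)).deriv.continuousAt.continuousWithinAt
    have e3 := Complex.continuous_ofReal.comp_continuousOn
      (e1.clm_apply (continuousOn_const (c := ((1 : ℝ), (0 : ℝ)))))
    have e4 := Complex.continuous_ofReal.comp_continuousOn
      (e1.clm_apply (continuousOn_const (c := ((0 : ℝ), (1 : ℝ)))))
    exact (e3.sub (continuousOn_const.mul e4)).mul
      (continuousOn_const.add (continuousOn_const.mul e2))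
  have hfdiff : ∀ z ∈ Ioo (x₀ - r / 3) (x₀ + r / 3) ×ℂ Ioo 0 (r / 3),
      DifferentiableAt ℂ f z := by
    intro z hz
    have hzO := hmapO z hz
    have e1 := (differentiableAt_complex_gradient (z := φ z)
      (hu.contDiffAt (hO.mem_nhds hzO)) (hl _ hzO)).comp z
        (hφd z (hball_rect z (hIoo hz))).differentiableAt
    have e2 := e1.fun_mul ((hF z (hball_rect z (hIoo hz))).deriv.differentiableAt.const_mul
      Complex.I |>.const_add 1)
    refine e2.congr_of_eventuallyEq ?_
    filter_upwards [(hPc z (hball_rect z (hIoo hz))).eventually (hO.mem_nhds hzO)] with w hw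
    have hfw : fderiv ℝ u ((φ w).re, (φ w).im) = u' (P w) := (hfd _ hw).fderiv
    simp only [hf, Function.comp, hfw]
  have hucont : ContinuousOn u (U \ Ω) := fun p hp => (hu' p hp).continuousWithinAt
  obtain ⟨K, hK, hKx⟩ := exists_analyticAt_eq_add_log_potential (a := x₀ - r / 3)
    (b := x₀ + r / 3) (d := r / 3) (x₀ := x₀) (f := f) (W := fun z => u (P z)) (by linarith)
    (by linarith) (by linarith) hfc hfdiff (hucont.comp hPcont hmap) fun z hz =>
      hasFDerivAt_comp_re_im (hfd _ (hmapO z hz)) (hφd z (hball_rect z (hIoo hz)))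
  refine ⟨x₀ - r / 3, x₀ + r / 3, by linarith, by linarith, hsub, K, hK, ?_⟩
  filter_upwards [hKx, Metric.ball_mem_nhds x₀ hρ] with x hx hxb
  rw [← hx, hφr x hxb, sub_eq_add_neg, ← mul_neg, ← intervalIntegral.integral_neg]
  congr 2
  refine intervalIntegral.integral_congr fun t ht => ?_
  rw [uIcc_of_le (by linarith)] at ht
  have htb := hsub ht
  have hts : t ∈ s := by
    have := (hball_r _ (hrect (hIcc t ht))).2.2.1
    rwa [hφr t htb] at this
  have hdt := deriv_eq_ofReal_deriv (hF _ (hball t htb)).differentiableAt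
    (hψ t hts).differentiableAt
    (Filter.mem_of_superset (Metric.isOpen_ball.mem_nhds htb) hFψ)
  have h3 : (-(deriv ψ t), (1 : ℝ)) =
      (-(deriv ψ t)) • ((1 : ℝ), (0 : ℝ)) + ((0 : ℝ), (1 : ℝ)) := by simp
  simp only [hf, hφr t htb, hdt, h3, map_add, map_smul]
  simp
  ring

theorem exists_analyticAt_cauchy_data {s : Set ℝ} (hs : IsOpen s) {ψ : ℝ → ℝ}
    (hψ : AnalyticOnNhd ℝ ψ s) {x₀ : ℝ} (hx₀ : x₀ ∈ s)
    {Ω U : Set (ℝ × ℝ)} (hΩ : Ω = {p : ℝ × ℝ | p.1 ∈ s ∧ p.2 < ψ p.1}) (hU : IsOpen U)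
    (hxU : (x₀, ψ x₀) ∈ U) {u : ℝ × ℝ → ℝ} {u' : ℝ × ℝ → ℝ × ℝ →L[ℝ] ℝ}
    (hu : ContDiffOn ℝ 2 u (U \ closure Ω))
    (hu' : ∀ p ∈ U \ Ω, HasFDerivWithinAt u (u' p) (U \ Ω) p) (hu'c : ContinuousOn u' (U \ Ω))
    (hl : ∀ p ∈ U \ closure Ω, lap u p = 0) {p q : ℝ} {k : ℝ → ℝ} (hpq : Ioo p q = s)
    (hψc : ContinuousOn ψ (Icc p q)) (hk : ContinuousOn k (Icc p q))
    (huk : ∀ t ∈ s, u' (t, ψ t) (-(deriv ψ t), 1) = k t) :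
    AnalyticAt ℝ (fun x => u (x, ψ x) - (1 / Real.pi) *
      ∫ t in p..q, k t * Real.log √((x - t) ^ 2 + (ψ x - ψ t) ^ 2)) x₀ := by
  obtain ⟨F, hF, hFψ⟩ := exists_complex_extension (hψ x₀ hx₀)
  obtain ⟨ρ₁, hρ₁, hFρ⟩ := Metric.eventually_nhds_iff_ball.1 hF.eventually_analyticAt
  obtain ⟨ρ₂, hρ₂, hψρ⟩ := Metric.eventually_nhds_iff_ball.1 (hFψ.and (hs.mem_nhds hx₀))
  set ρ := min ρ₁ ρ₂
  have hρ : 0 < ρ := lt_min hρ₁ hρ₂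
  have hFa : AnalyticOnNhd ℂ F (Metric.ball x₀ ρ) := fun z hz =>
    hFρ z (Metric.ball_subset_ball (min_le_left _ _) hz)
  have hFr : ∀ x ∈ Metric.ball x₀ ρ, F x = ψ x := fun x hx =>
    (hψρ x (Metric.ball_subset_ball (min_le_right _ _) hx)).1
  have hbs : Metric.ball x₀ ρ ⊆ s := fun x hx =>
    (hψρ x (Metric.ball_subset_ball (min_le_right _ _) hx)).2
  obtain ⟨a, b, ha, hb, hab, K₁, hK₁, hK₁x⟩ := exists_analyticAt_add_log_potential_of_laplace hs hψ
    hx₀ hρ hFa hFr hΩ hU hxU hu hu' hu'c hl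
  have hIcc : Icc a b ⊆ Ioo p q := hpq ▸ hab.trans hbs
  have hpa : p ≤ a := (hIcc (left_mem_Icc.2 (ha.trans hb).le)).1.le
  have hbq : b ≤ q := (hIcc (right_mem_Icc.2 (ha.trans hb).le)).2.le
  have hs1 : Icc p a ⊆ Icc p q := Icc_subset_Icc_right ((ha.trans hb).le.trans hbq)
  have hs2 : Icc b q ⊆ Icc p q := Icc_subset_Icc_left (hpa.trans (ha.trans hb).le)
  obtain ⟨K₂, hK₂, hK₂x⟩ := exists_analyticAt_integral_log_near (k := k) (ha.trans hb).le hρ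
    hFa.differentiableOn hab (fun x hx => (hψ x (hbs hx)).differentiableAt.differentiableWithinAt)
    hFr (hk.mono (hIcc.trans Ioo_subset_Icc_self))
  obtain ⟨K₃, hK₃, hK₃x⟩ := exists_analyticAt_integral_log_away (k := k) hpa
    (fun h => ha.not_ge h.2) hF hFψ (hψc.mono hs1) (hk.mono hs1)
  obtain ⟨K₄, hK₄, hK₄x⟩ := exists_analyticAt_integral_log_away (k := k) hbq
    (fun h => hb.not_ge h.1) hF hFψ (hψc.mono hs2) (hk.mono hs2)
  have hsum : AnalyticAt ℂ (fun z => K₁ z - ((1 / Real.pi : ℝ) : ℂ) * (K₂ z + K₃ z + K₄ z)) x₀ :=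
    hK₁.fun_sub (analyticAt_const.fun_mul ((hK₂.fun_add hK₃).fun_add hK₄))
  refine hsum.re_ofReal.congr ?_
  filter_upwards [hK₁x, hK₂x, hK₃x, hK₄x] with x h1 h2 h3 h4
  have hcong : ∫ t in a..b, u' (t, ψ t) (-(deriv ψ t), 1) * Real.log |x - t| =
      ∫ t in a..b, k t * Real.log |x - t| := by
    refine intervalIntegral.integral_congr fun t ht => ?_
    rw [uIcc_of_le (ha.trans hb).le] at ht
    simp only [huk t (hbs (hab ht))]
  rw [hcong] at h1
  rw [← intervalIntegral.integral_add_adjacent_intervals (h3.1.trans h2.1) h4.1,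
    ← intervalIntegral.integral_add_adjacent_intervals h3.1 h2.1, h2.2, h3.2, h4.2,
    Complex.sub_re, Complex.re_ofReal_mul, ← h1]
  simp only [Complex.add_re]
  ring

/-- necessity direction of the Hadamard-type theorem.
If the Cauchy problem for the Laplacian with Dirichlet data `g` and Neumann data `h` on the
analytic graph `Γ = {(x, Ψ x) : x ∈ (-1,1)}` has a solution on some open connected neighbourhood
`U` of `Γ`, of class `C²` on `U ∖ cl Ω` and `C¹` on `U ∖ Ω`, then
`H(x) = g(x) - (1/π) ∫_{-1}^1 h(t) √(1+Ψ'(t)²) log √((x-t)² + (Ψ(x)-Ψ(t))²) dt`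
is real analytic on `(-1,1)`. -/
theorem stmt0
    (Ψ g h : ℝ → ℝ)
    (hΨ : ∃ V : Set ℝ, IsOpen V ∧ Set.Icc (-1 : ℝ) 1 ⊆ V ∧ AnalyticOnNhd ℝ Ψ V)
    (hg : ContDiffOn ℝ 1 g (Set.Icc (-1 : ℝ) 1))
    (hh : ContDiffOn ℝ 1 h (Set.Icc (-1 : ℝ) 1))
    (Γ : Set (ℝ × ℝ)) (hΓ : Γ = {p : ℝ × ℝ | p.1 ∈ Set.Ioo (-1 : ℝ) 1 ∧ p.2 = Ψ p.1})
    (Ω : Set (ℝ × ℝ)) (hΩ : Ω = {p : ℝ × ℝ | p.1 ∈ Set.Ioo (-1 : ℝ) 1 ∧ p.2 < Ψ p.1})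
    (hex : ∃ (U : Set (ℝ × ℝ)) (u : ℝ × ℝ → ℝ) (u' : ℝ × ℝ → ℝ × ℝ →L[ℝ] ℝ),
      IsOpen U ∧ IsConnected U ∧ Γ ⊆ U ∧
      -- u ∈ C²(U ∖ cl Ω)
      ContDiffOn ℝ 2 u (U \ closure Ω) ∧
      -- u ∈ C¹(U ∖ Ω): u has continuous derivative u' up to the boundary
      (∀ p ∈ U \ Ω, HasFDerivWithinAt u (u' p) (U \ Ω) p) ∧
      ContinuousOn u' (U \ Ω) ∧
      -- Δu = 0 on U ∖ cl Ω
      (∀ p ∈ U \ closure Ω, lap u p = 0) ∧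
      -- u(x, Ψ x) = g x
      (∀ x ∈ Set.Ioo (-1 : ℝ) 1, u (x, Ψ x) = g x) ∧
      -- ∂u/∂n (x, Ψ x) = h x, where n(x) = (−Ψ'(x), 1)/√(1+Ψ'(x)²) points away from Ω
      (∀ x ∈ Set.Ioo (-1 : ℝ) 1,
        u' (x, Ψ x) ((Real.sqrt (1 + deriv Ψ x ^ 2))⁻¹ • (-(deriv Ψ x), (1 : ℝ))) = h x)) :
    AnalyticOnNhd ℝ
      (fun x => g x - (1 / Real.pi) * ∫ t in (-1 : ℝ)..1,
        h t * Real.sqrt (1 + deriv Ψ t ^ 2) *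
          Real.log (Real.sqrt ((x - t) ^ 2 + (Ψ x - Ψ t) ^ 2)))
      (Set.Ioo (-1 : ℝ) 1) := by
  subst hΩ hΓ
  obtain ⟨V, hV, hIV, hΨV⟩ := hΨ
  obtain ⟨U, u, u', hU, -, hΓU, hu, hu', hu'c, hl, hug, huh⟩ := hex
  intro x₀ hx₀
  have hΨs : AnalyticOnNhd ℝ Ψ (Ioo (-1) 1) := hΨV.mono (Ioo_subset_Icc_self.trans hIV)
  have hk : ContinuousOn (fun t => h t * √(1 + deriv Ψ t ^ 2)) (Icc (-1) 1) :=
    hh.continuousOn.mul (((hΨV.mono hIV).deriv.continuousOn.pow 2).const_add 1).sqrt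
  have huk : ∀ t ∈ Ioo (-1 : ℝ) 1,
      u' (t, Ψ t) (-(deriv Ψ t), 1) = h t * √(1 + deriv Ψ t ^ 2) := fun t ht => by
    have hpos : √(1 + deriv Ψ t ^ 2) ≠ 0 := by positivity
    rw [← huh t ht, map_smul, smul_eq_mul]
    field_simp
  refine (exists_analyticAt_cauchy_data isOpen_Ioo hΨs hx₀ rfl hU (hΓU ⟨hx₀, rfl⟩) hu hu' hu'c hl
    rfl (hΨV.mono hIV).continuousOn hk huk).congr ?_
  filter_upwards [isOpen_Ioo.mem_nhds hx₀] with x hx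
  rw [hug x hx]
end

section
/- Let Ψ:[-1,1]→ℝ have a real analytic extension to an open neighbourhood of [-1,1], let Γ = {(x,Ψ(x)) : x∈(-1,1)} and Ω = {(x,y)∈(-1,1)×ℝ : y<Ψ(x)}, and let n be the unit normal to Γ pointing away from Ω. Let g,h ∈ C¹([-1,1]). If the function H(x) := g(x) − (1/π)∫_{-1}^{1} h(t)√(1+Ψ'(t)²) · log√((x−t)² + (Ψ(x)−Ψ(t))²) dt is real analytic on (-1,1), then there exists an open connected neighbourhood U ⊂ ℝ² of Γ and a function u ∈ C²(U∖cl(Ω)) ∩ C¹(U∖Ω) with Δu = 0 on U∖cl(Ω), u(x,Ψ(x)) = g(x) and (∂u/∂n)(x,Ψ(x)) = h(x) for all x∈(-1,1). -/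
open MeasureTheory Filter Topology Set

theorem AnalyticAt.exists_complex_extension {f : ℝ → ℝ} {x : ℝ} (hf : AnalyticAt ℝ f x) :
    ∃ r > 0, ∃ F : ℂ → ℂ, DifferentiableOn ℂ F (Metric.ball (x : ℂ) r) ∧
      ∀ y : ℝ, (y : ℂ) ∈ Metric.ball (x : ℂ) r → F y = f y := by
  obtain ⟨p, ρ, hp⟩ := hf
  let q : FormalMultilinearSeries ℂ ℂ ℂ :=
    FormalMultilinearSeries.ofScalars ℂ (fun n => (p.coeff n : ℂ))
  have hrad : p.radius ≤ q.radius := by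
    refine ENNReal.le_of_forall_nnreal_lt fun r hr => ?_
    refine q.le_radius_of_summable_norm ?_
    refine (p.summable_norm_mul_pow hr).congr fun n => ?_
    simp [q]
  have hρ : ρ ≤ q.radius := hp.r_le.trans hrad
  obtain ⟨r, hr0, hr⟩ : ∃ r : NNReal, 0 < r ∧ (r : ENNReal) < ρ := by
    obtain ⟨r, h1, h2⟩ := ENNReal.lt_iff_exists_nnreal_btwn.1 hp.r_pos
    exact ⟨r, by exact_mod_cast h1, h2⟩
  have hq := q.hasFPowerSeriesOnBall (hp.r_pos.trans_le hρ)
  have hmem : ∀ z : ℂ, z ∈ Metric.ball (x : ℂ) r → z - x ∈ Metric.eball (0 : ℂ) q.radius := by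
    intro z hz
    refine Metric.eball_subset_eball (hr.le.trans hρ) ?_
    rw [Metric.eball_coe]
    simpa [dist_eq_norm] using hz
  refine ⟨r, by exact_mod_cast hr0, fun z => q.sum (z - x), ?_, ?_⟩
  · exact hq.differentiableOn.comp (by fun_prop) hmem
  · intro y hy
    have hy' : y - x ∈ Metric.eball (0 : ℝ) ρ := by
      refine Metric.eball_subset_eball hr.le ?_
      rw [Metric.eball_coe]
      have : ‖((y - x : ℝ) : ℂ)‖ < r := by simpa [dist_eq_norm] using hy
      rw [Complex.norm_real] at this
      simpa using this
    have h1 := hp.hasSum hy'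
    have h2 := hq.hasSum (hmem y hy)
    rw [zero_add] at h2
    rw [add_sub_cancel] at h1
    have h3 : HasSum (fun n => q n fun _ => (y : ℂ) - x) (f y : ℂ) := by
      have h4 := Complex.hasSum_ofReal.2 h1
      have h5 : (fun n => q n fun _ => (y : ℂ) - x) = fun n => ((p n fun _ => y - x : ℝ) : ℂ) := by
        funext n
        simp [q, FormalMultilinearSeries.coeff_ofScalars]
      rwa [h5]
    exact h2.unique h3

theorem AnalyticOnNhd.exists_complex_extension {f : ℝ → ℝ} {V : Set ℝ}
    (hf : AnalyticOnNhd ℝ f V) (hV : IsOpen V) :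
    ∃ (D : Set ℂ) (F : ℂ → ℂ), IsOpen D ∧ (∀ x ∈ V, (x : ℂ) ∈ D) ∧ DifferentiableOn ℂ F D ∧
      ∀ x ∈ V, F x = f x := by
  have key : ∀ x : V, ∃ r > 0, ∃ F : ℂ → ℂ, DifferentiableOn ℂ F (Metric.ball (x : ℂ) r) ∧
      ∀ y : ℝ, (y : ℂ) ∈ Metric.ball ((x : ℝ) : ℂ) r → y ∈ V ∧ F y = f y := by
    rintro ⟨x, hx⟩
    obtain ⟨r, hr, F, hF, hFf⟩ := (hf x hx).exists_complex_extension
    obtain ⟨s, hs, hsV⟩ := Metric.isOpen_iff.1 hV x hx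
    refine ⟨min r s, lt_min hr hs, F, hF.mono (Metric.ball_subset_ball (min_le_left _ _)), ?_⟩
    intro y hy
    refine ⟨hsV ?_, hFf y (Metric.ball_subset_ball (min_le_left _ _) hy)⟩
    have := Metric.ball_subset_ball (min_le_right r s) hy
    rw [Metric.mem_ball, dist_eq_norm, ← Complex.ofReal_sub, Complex.norm_real] at this
    simpa [dist_eq_norm] using this
  choose r hr F hF hFf using key
  let D : Set ℂ := ⋃ x : V, Metric.ball (x : ℂ) (r x)
  have hre : ∀ (x : V) (z : ℂ), z ∈ Metric.ball ((x : ℝ) : ℂ) (r x) →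
      ((z.re : ℝ) : ℂ) ∈ Metric.ball ((x : ℝ) : ℂ) (r x) := by
    intro x z hz
    rw [Metric.mem_ball, dist_eq_norm] at hz ⊢
    refine lt_of_le_of_lt ?_ hz
    rw [← Complex.ofReal_sub, Complex.norm_real]
    simpa using Complex.abs_re_le_norm (z - (x : ℝ))
  have hagree : ∀ (x y : V) (z : ℂ), z ∈ Metric.ball ((x : ℝ) : ℂ) (r x) →
      z ∈ Metric.ball ((y : ℝ) : ℂ) (r y) → F x z = F y z := by
    intro x y z hzx hzy
    have hopen : IsOpen (Metric.ball ((x : ℝ) : ℂ) (r x) ∩ Metric.ball ((y : ℝ) : ℂ) (r y)) :=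
      Metric.isOpen_ball.inter Metric.isOpen_ball
    have hconv := ((convex_ball ((x : ℝ) : ℂ) (r x)).inter
      (convex_ball ((y : ℝ) : ℂ) (r y))).isPreconnected
    have h1 := ((hF x).mono inter_subset_left).analyticOnNhd hopen
    have h2 := ((hF y).mono inter_subset_right).analyticOnNhd hopen
    refine h1.eqOn_of_preconnected_of_frequently_eq h2 hconv
      ⟨hre x z hzx, hre y z hzy⟩ ?_ ⟨hzx, hzy⟩
    have hev : ∀ᶠ t : ℝ in 𝓝[≠] z.re, F x (t : ℂ) = F y (t : ℂ) := by
      have : Tendsto (fun t : ℝ => (t : ℂ)) (𝓝[≠] z.re) (𝓝 ((z.re : ℝ) : ℂ)) :=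
        (Complex.continuous_ofReal.tendsto _).mono_left nhdsWithin_le_nhds
      filter_upwards [this (hopen.mem_nhds ⟨hre x z hzx, hre y z hzy⟩)] with t ht
      rw [(hFf x t ht.1).2, (hFf y t ht.2).2]
    have hT : Tendsto (fun t : ℝ => (t : ℂ)) (𝓝[≠] z.re) (𝓝[≠] ((z.re : ℝ) : ℂ)) := by
      refine tendsto_nhdsWithin_iff.2
        ⟨(Complex.continuous_ofReal.tendsto _).mono_left nhdsWithin_le_nhds, ?_⟩
      filter_upwards [self_mem_nhdsWithin] with t ht
      simpa using ht
    exact hT.frequently hev.frequently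
  classical
  let G : ℂ → ℂ := fun z => if hz : ∃ x : V, z ∈ Metric.ball ((x : ℝ) : ℂ) (r x)
    then F hz.choose z else 0
  have hG : ∀ (x : V) (z : ℂ), z ∈ Metric.ball ((x : ℝ) : ℂ) (r x) → G z = F x z := by
    intro x z hz
    have h : ∃ x : V, z ∈ Metric.ball ((x : ℝ) : ℂ) (r x) := ⟨x, hz⟩
    simp only [G, dif_pos h]
    exact hagree _ _ z h.choose_spec hz
  refine ⟨D, G, isOpen_iUnion fun x => Metric.isOpen_ball, ?_, ?_, ?_⟩
  · exact fun x hx => mem_iUnion.2 ⟨⟨x, hx⟩, Metric.mem_ball_self (hr _)⟩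
  · intro z hz
    obtain ⟨x, hx⟩ := mem_iUnion.1 hz
    have hn : Metric.ball ((x : ℝ) : ℂ) (r x) ∈ 𝓝 z := Metric.isOpen_ball.mem_nhds hx
    refine DifferentiableAt.differentiableWithinAt ?_
    refine ((hF x).differentiableAt hn).congr_of_eventuallyEq ?_
    filter_upwards [hn] with w hw using hG x w hw
  · intro x hx
    have := Metric.mem_ball_self (x := ((x : ℝ) : ℂ)) (hr ⟨x, hx⟩)
    rw [hG ⟨x, hx⟩ x this, (hFf ⟨x, hx⟩ x this).2]

theorem continuousAt_dslope_prod {P : ℂ → ℂ} {D : Set ℂ}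
    (hP : DifferentiableOn ℂ P D) (hD : IsOpen D) {a z : ℂ} (ha : a ∈ D) (hz : z ∈ D) :
    ContinuousAt (fun p : ℂ × ℂ => dslope P p.1 p.2) (a, z) := by
  have hPa : ∀ w ∈ D, ContinuousAt P w := fun w hw =>
    (hP.differentiableAt (hD.mem_nhds hw)).continuousAt
  rcases eq_or_ne a z with rfl | hne
  · have han : AnalyticAt ℂ P a := hP.analyticAt (hD.mem_nhds ha)
    have hs : HasStrictDerivAt P (deriv P a) a := han.hasStrictDerivAt
    have hd : ContinuousAt (fun p : ℂ × ℂ => deriv P p.1) (a, a) :=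
      ContinuousAt.comp (x := (a, a)) (f := Prod.fst) han.deriv.continuousAt continuousAt_fst
    rw [Metric.continuousAt_iff'] at hd ⊢
    intro ε hε
    have h1 := (hasStrictDerivAt_iff_hasStrictFDerivAt.1 hs).isLittleO.def (half_pos hε)
    filter_upwards [h1, hd ε hε] with p hp1 hp2
    rcases eq_or_ne p.2 p.1 with h | h
    · rw [h, dslope_same, dslope_same]
      exact hp2
    · rw [dslope_of_ne _ h, dslope_same, slope_def_field, dist_eq_norm]
      have hsub : p.2 - p.1 ≠ 0 := sub_ne_zero.2 h
      have hpos : 0 < ‖p.2 - p.1‖ := norm_pos_iff.2 hsub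
      have : (P p.2 - P p.1) / (p.2 - p.1) - deriv P a
          = -(P p.1 - P p.2 - (p.1 - p.2) * deriv P a) / (p.2 - p.1) := by
        field_simp; ring
      rw [this, norm_div, norm_neg, div_lt_iff₀ hpos]
      have h3 : ‖P p.1 - P p.2 - (p.1 - p.2) * deriv P a‖ ≤ ε / 2 * ‖p.1 - p.2‖ := by
        simpa using hp1
      rw [norm_sub_rev p.1 p.2] at h3
      nlinarith
  · have hev : ∀ᶠ p : ℂ × ℂ in 𝓝 (a, z),
        (p.2 - p.1)⁻¹ * (P p.2 - P p.1) = dslope P p.1 p.2 := by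
      have : ∀ᶠ p : ℂ × ℂ in 𝓝 (a, z), p.1 ≠ p.2 :=
        (isOpen_ne_fun continuous_fst continuous_snd).mem_nhds hne
      filter_upwards [this] with p hp
      rw [dslope_of_ne _ hp.symm, slope_def_field, div_eq_inv_mul]
    refine ContinuousAt.congr ?_ hev
    have h2 : ContinuousAt (fun p : ℂ × ℂ => P p.2) (a, z) :=
      ContinuousAt.comp (x := (a, z)) (f := Prod.snd) (hPa z hz) continuousAt_snd
    have h1 : ContinuousAt (fun p : ℂ × ℂ => P p.1) (a, z) :=
      ContinuousAt.comp (x := (a, z)) (f := Prod.fst) (hPa a ha) continuousAt_fst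
    exact ((continuousAt_snd.sub continuousAt_fst).inv₀ (sub_ne_zero.2 hne.symm)).mul (h2.sub h1)

theorem hasDerivAt_intervalIntegral_of_holomorphic {Φ : ℂ → ℝ → ℂ} {N : Set ℂ} {a b : ℝ}
    (hab : a ≤ b) (hN : IsOpen N)
    (hc : ContinuousOn (fun p : ℂ × ℝ => Φ p.1 p.2) (N ×ˢ Icc a b))
    (hd : ∀ t ∈ Icc a b, DifferentiableOn ℂ (fun z => Φ z t) N) {z : ℂ} (hz : z ∈ N) :
    HasDerivAt (fun z => ∫ t in a..b, Φ z t) (∫ t in a..b, deriv (fun z => Φ z t) z) z := by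
  obtain ⟨R, hR, hRN⟩ := Metric.isOpen_iff.1 hN z hz
  obtain ⟨r, hr, hrR⟩ : ∃ r > 0, 2 * r < R := ⟨R / 4, by positivity, by linarith⟩
  have hsub : Metric.closedBall z (2 * r) ⊆ N :=
    (Metric.closedBall_subset_ball hrR).trans hRN
  obtain ⟨M, hM⟩ :=
    ((isCompact_closedBall z (2 * r)).prod isCompact_Icc).exists_bound_of_continuousOn
    (hc.mono (prod_mono hsub Subset.rfl))
  have hcont : ∀ w ∈ N, ContinuousOn (Φ w) (Icc a b) := fun w hw =>
    hc.comp (f := fun t : ℝ => (w, t)) (by fun_prop) fun t ht => ⟨hw, ht⟩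
  have hI : ∀ w ∈ N, IntervalIntegrable (Φ w) volume a b := fun w hw =>
    ContinuousOn.intervalIntegrable (by rw [uIcc_of_le hab]; exact hcont w hw)
  have hIoc : uIoc a b ⊆ Icc a b := by rw [uIoc_of_le hab]; exact Ioc_subset_Icc_self
  have hder : ∀ t ∈ Icc a b, ∀ w ∈ Metric.ball z r,
      HasDerivAt (fun z => Φ z t) (deriv (fun z => Φ z t) w) w := fun t ht w hw =>
    ((hd t ht).differentiableAt
      (hN.mem_nhds (hRN (Metric.ball_subset_ball (by linarith) hw)))).hasDerivAt
  refine (intervalIntegral.hasDerivAt_integral_of_dominated_loc_of_deriv_le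
    (F' := fun w t => deriv (fun z => Φ z t) w) (bound := fun _ => M / r)
    (Metric.ball_mem_nhds z hr) ?_ (hI z hz) ?_ ?_ intervalIntegrable_const ?_).2
  · filter_upwards [hN.mem_nhds hz] with w hw
    exact (hI w hw).def'.aestronglyMeasurable
  · let u : ℕ → ℂ := fun n => z + (r : ℂ) * (1 / ((n : ℂ) + 1))
    have hu0 : Tendsto u atTop (𝓝 z) := by
      have := (tendsto_one_div_add_atTop_nhds_zero_nat (𝕜 := ℂ)).const_mul (r : ℂ)
      simpa [u] using this.const_add z
    have hun : ∀ n, u n ≠ z := fun n => by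
      have : ((n : ℂ) + 1) ≠ 0 := by exact_mod_cast Nat.succ_ne_zero n
      have hr' : (r : ℂ) ≠ 0 := by exact_mod_cast hr.ne'
      simp [u, this, hr']
    have huN : ∀ n, u n ∈ N := fun n => by
      refine hsub ?_
      rw [Metric.mem_closedBall, dist_eq_norm]
      have h1 : ‖(1 / ((n : ℂ) + 1))‖ ≤ 1 := by
        rw [norm_div, norm_one]
        have : ‖(n : ℂ) + 1‖ = n + 1 := by
          have : ((n : ℂ) + 1) = ((n + 1 : ℕ) : ℂ) := by push_cast; rfl
          rw [this, Complex.norm_natCast]; push_cast; rfl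
        rw [this]
        exact div_le_one_of_le₀ (by linarith [n.cast_nonneg (α := ℝ)]) (by positivity)
      have : ‖u n - z‖ = r * ‖(1 / ((n : ℂ) + 1))‖ := by
        simp only [u, add_sub_cancel_left, norm_mul, Complex.norm_real, Real.norm_eq_abs,
          abs_of_pos hr]
      rw [this]
      nlinarith
    have hu : Tendsto u atTop (𝓝[≠] z) :=
      tendsto_nhdsWithin_iff.2 ⟨hu0, Eventually.of_forall hun⟩
    refine aestronglyMeasurable_of_tendsto_ae atTop
      (f := fun n t => slope (fun w => Φ w t) z (u n)) (fun n => ?_) ?_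
    · have := ((hI _ (huN n)).sub (hI z hz)).const_mul ((u n - z)⁻¹)
      simpa [slope_def_field, div_eq_inv_mul] using this.def'.aestronglyMeasurable
    · refine (ae_restrict_iff' measurableSet_uIoc).2 (Eventually.of_forall fun t ht => ?_)
      exact (hder t (hIoc ht) z (Metric.mem_ball_self hr)).tendsto_slope.comp hu
  · refine Eventually.of_forall fun t ht w hw => ?_
    have hw' : dist w z < r := hw
    refine Complex.norm_deriv_le_of_forall_mem_sphere_norm_le hr ?_ ?_
    · refine (DifferentiableOn.mono (hd t (hIoc ht)) ?_).diffContOnCl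
      rw [closure_ball _ hr.ne']
      exact (Metric.closedBall_subset_closedBall' (by linarith)).trans hsub
    · intro v hv
      refine hM (v, t) ⟨?_, hIoc ht⟩
      refine Metric.closedBall_subset_closedBall' (x := w) (ε₁ := r) (by linarith) ?_
      exact Metric.sphere_subset_closedBall hv
  · exact Eventually.of_forall fun t ht w hw => hder t (hIoc ht) w hw

theorem deriv_eq_ofReal_of_eqOn {P : ℂ → ℂ} {f : ℝ → ℝ} {V : Set ℝ} (hV : IsOpen V) {x : ℝ}
    (hx : x ∈ V) (hP : DifferentiableAt ℂ P x) (hf : DifferentiableAt ℝ f x)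
    (h : ∀ y ∈ V, P y = f y) : deriv P x = (deriv f x : ℝ) := by
  have h1 : HasDerivAt (fun y : ℝ => P y) (deriv P x) x := hP.hasDerivAt.comp_ofReal
  have h2 : HasDerivAt (fun y : ℝ => (f y : ℂ)) ((deriv f x : ℝ) : ℂ) x :=
    hf.hasDerivAt.ofReal_comp
  refine h1.unique (h2.congr_of_eventuallyEq ?_)
  filter_upwards [hV.mem_nhds hx] with y hy using h y hy

theorem analyticAt_integral_mul_log_one_add_sq_slope {Ψ k : ℝ → ℝ} {V : Set ℝ} {a b : ℝ}
    (hab : a ≤ b) (hV : IsOpen V) (habV : Icc a b ⊆ V) {D : Set ℂ} {P : ℂ → ℂ} (hD : IsOpen D)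
    (hVD : ∀ x ∈ V, (x : ℂ) ∈ D) (hP : DifferentiableOn ℂ P D) (hPΨ : ∀ x ∈ V, P x = Ψ x)
    (hΨ : DifferentiableOn ℝ Ψ V) (hk : ContinuousOn k (Icc a b)) {x : ℝ} (hx : x ∈ V) :
    AnalyticAt ℝ (fun x => ∫ t in a..b, k t * Real.log (1 + slope Ψ t x ^ 2)) x := by
  have hreal : ∀ t ∈ V, ∀ y ∈ V, dslope P (t : ℂ) (y : ℂ) = (dslope Ψ t y : ℝ) := by
    intro t ht y hy
    rcases eq_or_ne y t with rfl | hne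
    · rw [dslope_same, dslope_same]
      exact deriv_eq_ofReal_of_eqOn hV ht (hP.differentiableAt (hD.mem_nhds (hVD _ ht)))
        (hΨ.differentiableAt (hV.mem_nhds ht)) hPΨ
    · rw [dslope_of_ne _ hne, dslope_of_ne _ (by exact_mod_cast hne), slope_def_field,
        slope_def_field, hPΨ _ ht, hPΨ _ hy]
      push_cast; rfl
  have hcd : ∀ z ∈ D, ∀ t ∈ V,
      ContinuousAt (fun p : ℂ × ℝ => 1 + dslope P (p.2 : ℂ) p.1 ^ 2) (z, t) := by
    intro z hz t ht
    have h1 := continuousAt_dslope_prod hP hD (hVD t ht) hz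
    have h2 : ContinuousAt (fun p : ℂ × ℝ => ((p.2 : ℂ), p.1)) (z, t) := by fun_prop
    have h3 : ContinuousAt (fun p : ℂ × ℝ => dslope P (p.2 : ℂ) p.1) (z, t) :=
      ContinuousAt.comp (x := (z, t)) (f := fun p : ℂ × ℝ => ((p.2 : ℂ), p.1))
        (g := fun p : ℂ × ℂ => dslope P p.1 p.2) h1 h2
    exact continuousAt_const.add (h3.pow 2)
  have hev : ∀ᶠ z in 𝓝 (x : ℂ), ∀ t ∈ Icc a b, 1 + dslope P (t : ℂ) z ^ 2 ∈ Complex.slitPlane := by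
    refine isCompact_Icc.eventually_forall_of_forall_eventually fun t ht => ?_
    refine (hcd x (hVD x hx) t (habV ht)).eventually_mem (Complex.isOpen_slitPlane.mem_nhds ?_)
    simp only [hreal t (habV ht) x hx]
    refine Or.inl ?_
    norm_cast
    positivity
  obtain ⟨N, hNsub, hN, hxN⟩ := mem_nhds_iff.1 (inter_mem hev (hD.mem_nhds (hVD x hx)))
  let Φ : ℂ → ℝ → ℂ := fun z t => (k t : ℂ) * Complex.log (1 + dslope P (t : ℂ) z ^ 2)
  have hdiff : DifferentiableOn ℂ (fun z => ∫ t in a..b, Φ z t) N := by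
    intro z hz
    refine (hasDerivAt_intervalIntegral_of_holomorphic hab hN ?_ ?_
      hz).differentiableAt.differentiableWithinAt
    · rintro ⟨w, t⟩ ⟨hw, ht⟩
      have h1 : ContinuousWithinAt (fun p : ℂ × ℝ => (k p.2 : ℂ)) (N ×ˢ Icc a b) (w, t) :=
        Complex.continuous_ofReal.continuousAt.comp_continuousWithinAt
          ((hk t ht).comp continuousWithinAt_snd fun p hp => hp.2)
      have h2 := (hcd w (hNsub hw).2 t (habV ht)).clog ((hNsub hw).1 t ht)
      exact h1.mul h2.continuousWithinAt
    · intro t ht w hw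
      have h1 : DifferentiableOn ℂ (dslope P (t : ℂ)) D :=
        (Complex.differentiableOn_dslope (hD.mem_nhds (hVD t (habV ht)))).2 hP
      have h2 := h1.differentiableAt (hD.mem_nhds (hNsub hw).2)
      exact (((h2.pow 2).const_add 1).clog ((hNsub hw).1 t ht)).const_mul _
        |>.differentiableWithinAt
  have han : AnalyticAt ℂ (fun z => ∫ t in a..b, Φ z t) x := hdiff.analyticAt (hN.mem_nhds hxN)
  refine han.re_ofReal.congr ?_
  filter_upwards [hV.mem_nhds hx] with y hy
  have h1 : ∫ t in a..b, Φ y t =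
      ((∫ t in a..b, k t * Real.log (1 + dslope Ψ t y ^ 2) : ℝ) : ℂ) := by
    rw [← intervalIntegral.integral_ofReal]
    refine intervalIntegral.integral_congr fun t ht => ?_
    rw [uIcc_of_le hab] at ht
    simp only [Φ]
    rw [hreal t (habV ht) y hy, Complex.ofReal_mul, Complex.ofReal_log (by positivity)]
    push_cast; rfl
  rw [h1, Complex.ofReal_re]
  refine intervalIntegral.integral_congr_ae ?_
  have : ∀ᵐ t : ℝ, t ≠ y := by simp [ae_iff, measure_singleton]
  filter_upwards [this] with t ht _
  rw [dslope_of_ne _ ht.symm]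

/-- The logarithmic potential `z ↦ ∫ t in a..b, φ t * log (z - t)`. -/
noncomputable def logPotential (a b : ℝ) (φ : ℝ → ℝ) (z : ℂ) : ℂ :=
  ∫ t in a..b, (φ t : ℂ) * Complex.log (z - t)

theorem continuousWithinAt_log_im_nonneg {w : ℂ} (hw : w ≠ 0) :
    ContinuousWithinAt Complex.log {z | 0 ≤ z.im} w := by
  by_cases h : w ∈ Complex.slitPlane
  · exact (continuousAt_clog h).continuousWithinAt
  · rw [Complex.mem_slitPlane_iff, not_or, not_lt, not_not] at h
    have hre : w.re < 0 := lt_of_le_of_ne h.1 fun h0 => hw (Complex.ext h0 h.2)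
    exact Complex.continuousWithinAt_log_of_re_neg_of_im_zero hre h.2

theorem norm_log_le (w : ℂ) : ‖Complex.log w‖ ≤ |Real.log ‖w‖| + Real.pi := by
  refine (Complex.norm_le_abs_re_add_abs_im _).trans ?_
  rw [Complex.log_re, Complex.log_im]
  gcongr
  exact Complex.abs_arg_le_pi w

theorem intervalIntegrable_mul_log_sub {a b : ℝ} (hab : a ≤ b) {φ : ℝ → ℝ}
    (hφ : ContinuousOn φ (Icc a b)) (x : ℝ) :
    IntervalIntegrable (fun t : ℝ => (φ t : ℂ) * Complex.log ((x : ℂ) - t)) volume a b := by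
  have h1 : IntervalIntegrable (fun t : ℝ => |Real.log (x - t)| + Real.pi) volume a b := by
    refine IntervalIntegrable.add ?_ intervalIntegrable_const
    have h0 : IntervalIntegrable Real.log volume (x - a) (x - b) :=
      intervalIntegral.intervalIntegrable_log'
    have h := h0.comp_sub_left x
    simp only [sub_sub_cancel] at h
    exact h.abs
  have h2 : IntervalIntegrable (fun t : ℝ => Complex.log ((x : ℂ) - t)) volume a b := by
    refine h1.mono_fun ?_ (Eventually.of_forall fun t => ?_)
    · exact (Complex.measurable_log.comp
        (measurable_const.sub Complex.measurable_ofReal)).aestronglyMeasurable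
    · refine (norm_log_le _).trans ?_
      rw [← Complex.ofReal_sub, Complex.norm_real, Real.norm_eq_abs, Real.log_abs]
      exact le_abs_self _
  refine h2.continuousOn_mul ?_
  rw [uIcc_of_le hab]
  exact Complex.continuous_ofReal.comp_continuousOn hφ

theorem logPotential_congr {a b : ℝ} (hab : a ≤ b) {φ ψ : ℝ → ℝ} (h : EqOn φ ψ (Icc a b)) :
    logPotential a b φ = logPotential a b ψ := by
  funext z
  refine intervalIntegral.integral_congr fun t ht => ?_
  rw [uIcc_of_le hab] at ht
  simp only [h ht]

theorem logPotential_eq_integral_translate {a b : ℝ} (hab : a ≤ b) (φ : ℝ → ℝ) (z : ℂ) :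
    logPotential a b φ z = ∫ s : ℝ, (((Ioc a b).indicator φ (z.re - s) : ℝ) : ℂ) *
      Complex.log (s + z.im * Complex.I) := by
  rw [logPotential, intervalIntegral.integral_of_le hab, ← integral_indicator measurableSet_Ioc,
    ← integral_sub_left_eq_self _ volume z.re]
  refine integral_congr_ae (Eventually.of_forall fun s => ?_)
  simp only
  by_cases hs : z.re - s ∈ Ioc a b
  · rw [indicator_of_mem hs, indicator_of_mem hs]
    have : z - ((z.re - s : ℝ) : ℂ) = s + z.im * Complex.I := by
      apply Complex.ext <;> simp
    rw [this]
  · rw [indicator_of_notMem hs, indicator_of_notMem hs]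
    simp

theorem continuousOn_logPotential_of_continuous {a b : ℝ} (hab : a ≤ b) {φ : ℝ → ℝ}
    (hφ : Continuous φ) : ContinuousOn (logPotential a b φ) {z | 0 ≤ z.im} := by
  intro z₀ hz₀
  simp only [funext (logPotential_eq_integral_translate hab φ)]
  obtain ⟨M, hM⟩ := isCompact_Icc.exists_bound_of_continuousOn (hφ.continuousOn (s := Icc a b))
  have hM0 : 0 ≤ M := (norm_nonneg _).trans (hM a (left_mem_Icc.2 hab))
  set J : Set ℝ := Icc (z₀.re - 1 - b) (z₀.re + 1 - a) with hJ
  set C : ℝ := |z₀.re| + 1 + |a| + |b| + (|z₀.im| + 1) with hC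
  have hae : ∀ c : ℝ, ∀ᵐ s : ℝ, s ≠ c := fun c => by simp [ae_iff, measure_singleton]
  have hmeas : Measurable ((Ioc a b).indicator φ) := hφ.measurable.indicator measurableSet_Ioc
  refine continuousWithinAt_of_dominated
    (bound := J.indicator fun s => M * (|Real.log s| + |Real.log C| + Real.pi)) ?_ ?_ ?_ ?_
  · refine Eventually.of_forall fun z => Measurable.aestronglyMeasurable ?_
    refine (Complex.measurable_ofReal.comp (hmeas.comp (measurable_const.sub measurable_id))).mul ?_
    exact Complex.measurable_log.comp (Complex.measurable_ofReal.add measurable_const)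
  · filter_upwards [mem_nhdsWithin_of_mem_nhds (Metric.ball_mem_nhds z₀ one_pos)] with z hz
    filter_upwards [hae 0] with s hs
    rw [Metric.mem_ball, dist_eq_norm] at hz
    have hre : |z.re - z₀.re| < 1 := (Complex.abs_re_le_norm (z - z₀)).trans_lt hz
    have him : |z.im - z₀.im| < 1 := (Complex.abs_im_le_norm (z - z₀)).trans_lt hz
    have him' : |z.im| ≤ |z₀.im| + 1 := by
      have := abs_sub_abs_le_abs_sub z.im z₀.im
      linarith
    rw [abs_lt] at hre
    by_cases hm : z.re - s ∈ Ioc a b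
    · have hsJ : s ∈ J := ⟨by linarith [hm.2], by linarith [hm.1]⟩
      rw [indicator_of_mem hm, indicator_of_mem hsJ, norm_mul, Complex.norm_real]
      have h1 : ‖φ (z.re - s)‖ ≤ M := hM _ (Ioc_subset_Icc_self hm)
      have hsabs : |s| ≤ |z₀.re| + 1 + |a| + |b| := by
        rw [abs_le]
        constructor <;> linarith [hsJ.1, hsJ.2, neg_abs_le z₀.re, le_abs_self z₀.re, le_abs_self b,
          neg_abs_le a, abs_nonneg a, abs_nonneg b]
      have hlow : |s| ≤ ‖(s : ℂ) + z.im * Complex.I‖ := by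
        simpa using Complex.abs_re_le_norm ((s : ℂ) + z.im * Complex.I)
      have hup : ‖(s : ℂ) + z.im * Complex.I‖ ≤ C := by
        refine (norm_add_le _ _).trans ?_
        rw [norm_mul, Complex.norm_I, mul_one, Complex.norm_real, Complex.norm_real,
          Real.norm_eq_abs, Real.norm_eq_abs]
        linarith
      have hs0 : 0 < |s| := abs_pos.2 hs
      have hl1 : Real.log s ≤ Real.log ‖(s : ℂ) + z.im * Complex.I‖ := by
        rw [← Real.log_abs s]
        exact Real.log_le_log hs0 hlow
      have hl2 : Real.log ‖(s : ℂ) + z.im * Complex.I‖ ≤ Real.log C :=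
        Real.log_le_log (hs0.trans_le hlow) hup
      have h2 : |Real.log ‖(s : ℂ) + z.im * Complex.I‖| ≤ |Real.log s| + |Real.log C| := by
        rw [abs_le]
        constructor <;> linarith [neg_abs_le (Real.log s), le_abs_self (Real.log C),
          abs_nonneg (Real.log s), abs_nonneg (Real.log C)]
      refine mul_le_mul h1 ?_ (norm_nonneg _) hM0
      linarith [norm_log_le ((s : ℂ) + z.im * Complex.I)]
    · rw [indicator_of_notMem hm]
      simp only [Complex.ofReal_zero, zero_mul, norm_zero]
      exact indicator_nonneg (fun s _ => by positivity) s
  · rw [integrable_indicator_iff measurableSet_Icc]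
    have h0 : IntervalIntegrable (fun s : ℝ => M * (|Real.log s| + |Real.log C| + Real.pi)) volume
        (z₀.re - 1 - b) (z₀.re + 1 - a) :=
      (((intervalIntegral.intervalIntegrable_log' (a := z₀.re - 1 - b) (b := z₀.re + 1 - a)).abs.add
        intervalIntegrable_const).add intervalIntegrable_const).const_mul M
    exact (intervalIntegrable_iff_integrableOn_Icc_of_le (by linarith)).1 h0
  · filter_upwards [hae 0, hae (z₀.re - a), hae (z₀.re - b)] with s h0 ha hb
    have hψ : ContinuousAt ((Ioc a b).indicator φ) (z₀.re - s) := by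
      by_cases hm : z₀.re - s ∈ Ioc a b
      · have : Ioc a b ∈ 𝓝 (z₀.re - s) :=
          Ioc_mem_nhds hm.1 (lt_of_le_of_ne hm.2 fun h => hb (by linarith))
        refine hφ.continuousAt.congr ?_
        filter_upwards [this] with t ht using (indicator_of_mem ht φ).symm
      · have : (Icc a b)ᶜ ∈ 𝓝 (z₀.re - s) :=
          isClosed_Icc.isOpen_compl.mem_nhds fun h =>
            hm ⟨lt_of_le_of_ne h.1 fun h' => ha (by linarith), h.2⟩
        refine (continuousAt_const (y := (0 : ℝ))).congr ?_
        filter_upwards [this] with t ht using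
          (indicator_of_notMem (fun h => ht (Ioc_subset_Icc_self h)) φ).symm
    have h1 : ContinuousAt (fun z : ℂ => (((Ioc a b).indicator φ (z.re - s) : ℝ) : ℂ)) z₀ := by
      refine Complex.continuous_ofReal.continuousAt.comp ?_
      exact ContinuousAt.comp (f := fun z : ℂ => z.re - s) hψ
        (Complex.continuous_re.continuousAt.sub continuousAt_const)
    refine h1.continuousWithinAt.mul ?_
    refine ContinuousWithinAt.comp (t := {z : ℂ | 0 ≤ z.im}) (g := Complex.log)
      (f := fun z : ℂ => (s : ℂ) + z.im * Complex.I)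
      (continuousWithinAt_log_im_nonneg fun h => h0 ?_) ?_ ?_
    · simpa using congrArg Complex.re h
    · fun_prop
    · intro z hz
      simpa using hz

theorem continuousOn_logPotential {a b : ℝ} (hab : a ≤ b) {φ : ℝ → ℝ}
    (hφ : ContinuousOn φ (Icc a b)) : ContinuousOn (logPotential a b φ) {z | 0 ≤ z.im} := by
  have h : Continuous (IccExtend hab ((Icc a b).domRestrict φ)) :=
    (continuousOn_iff_continuous_domRestrict.1 hφ).Icc_extend'
  rw [logPotential_congr hab (ψ := IccExtend hab ((Icc a b).domRestrict φ)) fun t ht => by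
    rw [IccExtend_of_mem _ _ ht]; rfl]
  exact continuousOn_logPotential_of_continuous hab h

theorem sub_ofReal_mem_slitPlane {z : ℂ} (hz : 0 < z.im) (t : ℝ) : z - t ∈ Complex.slitPlane :=
  Or.inr (by simpa using hz.ne')

theorem hasDerivAt_logPotential {a b : ℝ} (hab : a ≤ b) {φ : ℝ → ℝ}
    (hφ : ContinuousOn φ (Icc a b)) {z : ℂ} (hz : 0 < z.im) :
    HasDerivAt (logPotential a b φ) (∫ t in a..b, (φ t : ℂ) * (z - t)⁻¹) z := by
  have hder : ∀ (t : ℝ) (w : ℂ), 0 < w.im →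
      HasDerivAt (fun z : ℂ => (φ t : ℂ) * Complex.log (z - t)) ((φ t : ℂ) * (w - t)⁻¹) w := by
    intro t w hw
    have := (((hasDerivAt_id w).sub_const (t : ℂ)).clog (sub_ofReal_mem_slitPlane hw t)).const_mul
      (φ t : ℂ)
    simpa using this
  have hN : IsOpen {z : ℂ | 0 < z.im} := isOpen_lt continuous_const Complex.continuous_im
  have h := hasDerivAt_intervalIntegral_of_holomorphic hab hN
    (Φ := fun z t => (φ t : ℂ) * Complex.log (z - t)) ?_
    (fun t _ w hw => (hder t w hw).differentiableAt.differentiableWithinAt) hz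
  · simp only [(hder _ z hz).deriv] at h
    exact h
  · refine ContinuousOn.mul ?_ ?_
    · exact Complex.continuous_ofReal.comp_continuousOn
        (hφ.comp continuousOn_snd fun p hp => hp.2)
    · exact ContinuousOn.clog (by fun_prop) fun p hp => sub_ofReal_mem_slitPlane hp.1 _

theorem integral_mul_inv_sub_eq {a b : ℝ} (hab : a ≤ b) {k k' : ℝ → ℝ}
    (hk : ∀ t ∈ Icc a b, HasDerivWithinAt k (k' t) (Icc a b) t) (hk' : ContinuousOn k' (Icc a b))
    {z : ℂ} (hz : 0 < z.im) :
    ∫ t in a..b, (k t : ℂ) * (z - t)⁻¹ =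
      k a * Complex.log (z - a) - k b * Complex.log (z - b) + logPotential a b k' z := by
  have hne : ∀ t : ℝ, z - t ≠ 0 := fun t =>
    Complex.slitPlane_ne_zero (sub_ofReal_mem_slitPlane hz t)
  have hv : ∀ t : ℝ, HasDerivAt (fun t : ℝ => -Complex.log (z - t)) ((z - t)⁻¹) t := by
    intro t
    have h1 : HasDerivAt (fun t : ℝ => z - (t : ℂ)) (-1) t := by
      simpa using ((hasDerivAt_id t).ofReal_comp).const_sub z
    have h2 := (h1.clog_real (sub_ofReal_mem_slitPlane hz t)).neg
    rw [neg_div, neg_neg, one_div] at h2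
    exact h2
  have h := intervalIntegral.integral_mul_deriv_eq_deriv_mul_of_hasDerivWithinAt (a := a) (b := b)
    (u := fun t => (k t : ℂ)) (u' := fun t => (k' t : ℂ)) (v := fun t : ℝ => -Complex.log (z - t))
    (v' := fun t : ℝ => (z - t)⁻¹) ?_ (fun t _ => (hv t).hasDerivWithinAt) ?_ ?_
  · rw [h, logPotential]
    simp only [mul_neg, intervalIntegral.integral_neg]
    ring
  · rw [uIcc_of_le hab]
    exact fun t ht => (hk t ht).ofReal_comp
  · refine ContinuousOn.intervalIntegrable ?_
    rw [uIcc_of_le hab]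
    exact Complex.continuous_ofReal.comp_continuousOn hk'
  · refine Continuous.intervalIntegrable ?_ _ _
    exact Continuous.inv₀ (by fun_prop) hne

theorem continuousWithinAt_logPotential_deriv {a b : ℝ} (hab : a ≤ b) (k : ℝ → ℝ) {k' : ℝ → ℝ}
    (hk' : ContinuousOn k' (Icc a b)) {z : ℂ} (hz : 0 ≤ z.im) (hza : z ≠ a) (hzb : z ≠ b) :
    ContinuousWithinAt (fun z : ℂ => k a * Complex.log (z - a) - k b * Complex.log (z - b) +
      logPotential a b k' z) {z | 0 ≤ z.im} z := by
  have h : ∀ c : ℝ, z ≠ c →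
      ContinuousWithinAt (fun z : ℂ => Complex.log (z - c)) {z | 0 ≤ z.im} z := by
    intro c hc
    refine ContinuousWithinAt.comp (t := {z : ℂ | 0 ≤ z.im}) (g := Complex.log)
      (f := fun z : ℂ => z - c) (continuousWithinAt_log_im_nonneg (sub_ne_zero.2 hc)) ?_ ?_
    · fun_prop
    · intro w hw
      simpa using hw
  exact ((continuousWithinAt_const.mul (h a hza)).sub (continuousWithinAt_const.mul (h b hzb))).add
    (continuousOn_logPotential hab hk' z hz)

theorem hasDerivWithinAt_logPotential {a b : ℝ} (hab : a ≤ b) {k k' : ℝ → ℝ}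
    (hk : ∀ t ∈ Icc a b, HasDerivWithinAt k (k' t) (Icc a b) t) (hk' : ContinuousOn k' (Icc a b))
    {z : ℂ} (hz : 0 ≤ z.im) (hza : z ≠ a) (hzb : z ≠ b) :
    HasDerivWithinAt (logPotential a b k) (k a * Complex.log (z - a) - k b * Complex.log (z - b) +
      logPotential a b k' z) {z | 0 ≤ z.im} z := by
  have hkc : ContinuousOn k (Icc a b) := fun t ht => (hk t ht).continuousWithinAt
  set d : ℂ → ℂ := fun z => k a * Complex.log (z - a) - k b * Complex.log (z - b) +
    logPotential a b k' z with hd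
  have hder : ∀ w : ℂ, 0 < w.im → HasDerivAt (logPotential a b k) (d w) w := fun w hw => by
    simp only [hd]
    rw [← integral_mul_inv_sub_eq hab hk hk' hw]
    exact hasDerivAt_logPotential hab hkc hw
  have hcl : closure {z : ℂ | 0 < z.im} = {z | 0 ≤ z.im} := Complex.closure_setOfPred_lt_im 0
  have hsub : {z : ℂ | 0 < z.im} ⊆ {z | 0 ≤ z.im} := fun w (hw : 0 < w.im) => hw.le
  let T : ℂ → ℂ →L[ℝ] ℂ := fun c =>
    (ContinuousLinearMap.toSpanSingleton ℂ c).restrictScalars ℝ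
  have hT : Continuous T := by
    have : T = fun c => (ContinuousLinearMap.mul ℝ ℂ).flip c := by
      funext c
      ext w
      simp [T, mul_comm]
    rw [this]
    exact ContinuousLinearMap.continuous _
  have h := hasFDerivWithinAt_closure_of_tendsto_fderiv (f := logPotential a b k)
    (s := {z : ℂ | 0 < z.im}) (x := z) (f' := T (d z)) ?_ (convex_halfSpace_im_gt 0)
    (isOpen_lt continuous_const Complex.continuous_im) ?_ ?_
  · rw [hcl] at h
    exact HasFDerivWithinAt.of_restrictScalars ℝ h rfl
  · exact fun w hw => ((hder w hw).differentiableAt.restrictScalars ℝ).differentiableWithinAt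
  · intro w hw
    rw [hcl] at hw
    exact (continuousOn_logPotential hab hkc w hw).mono hsub
  · have h1 : Tendsto (fun w => T (d w)) (𝓝[{z : ℂ | 0 < z.im}] z) (𝓝 (T (d z))) :=
      (hT.tendsto _).comp
        ((continuousWithinAt_logPotential_deriv hab k hk' hz hza hzb).mono hsub)
    refine h1.congr' ?_
    filter_upwards [self_mem_nhdsWithin] with w hw
    exact ((hder w hw).hasFDerivAt.restrictScalars ℝ).fderiv.symm

theorem re_logPotential_ofReal {a b : ℝ} (hab : a ≤ b) {φ : ℝ → ℝ}
    (hφ : ContinuousOn φ (Icc a b)) (x : ℝ) :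
    (logPotential a b φ x).re = ∫ t in a..b, φ t * Real.log (x - t) := by
  have h := Complex.reCLM.intervalIntegral_comp_comm (intervalIntegrable_mul_log_sub hab hφ x)
  rw [logPotential, ← Complex.reCLM_apply, ← h]
  refine intervalIntegral.integral_congr fun t _ => ?_
  simp only [Complex.reCLM_apply, Complex.re_ofReal_mul, Complex.log_re]
  rw [← Complex.ofReal_sub, Complex.norm_real, Real.norm_eq_abs, Real.log_abs]

theorem im_logPotential_deriv_ofReal {a b : ℝ} {k k' : ℝ → ℝ}
    (hk : ∀ t ∈ Icc a b, HasDerivWithinAt k (k' t) (Icc a b) t) (hk' : ContinuousOn k' (Icc a b))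
    {x : ℝ} (hx : x ∈ Ioo a b) :
    (k a * Complex.log (x - a) - k b * Complex.log (x - b) + logPotential a b k' x).im =
      -(Real.pi * k x) := by
  have hab : a ≤ b := (hx.1.trans hx.2).le
  have h := Complex.imCLM.intervalIntegral_comp_comm (intervalIntegrable_mul_log_sub hab hk' x)
  have hint := (intervalIntegrable_mul_log_sub hab hk' x)
  have hpos : ∀ t : ℝ, t ≤ x → (Complex.log ((x : ℂ) - t)).im = 0 := by
    intro t ht
    rw [Complex.log_im, ← Complex.ofReal_sub, Complex.arg_ofReal_of_nonneg (by linarith)]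
  have hneg : ∀ t : ℝ, x < t → (Complex.log ((x : ℂ) - t)).im = Real.pi := by
    intro t ht
    rw [Complex.log_im, ← Complex.ofReal_sub, Complex.arg_ofReal_of_neg (by linarith)]
  have hFTC : ∫ t in x..b, k' t = k b - k x := by
    have hsub : Icc x b ⊆ Icc a b := Icc_subset_Icc_left hx.1.le
    refine intervalIntegral.integral_eq_sub_of_hasDerivAt_of_le hx.2.le
      (fun t ht => (hk t (hsub ht)).continuousWithinAt.mono hsub) (fun t ht => ?_)
      (ContinuousOn.intervalIntegrable (by rw [uIcc_of_le hx.2.le]; exact hk'.mono hsub))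
    exact (hk t (hsub (Ioo_subset_Icc_self ht))).hasDerivAt
      (Icc_mem_nhds (hx.1.trans ht.1) ht.2)
  have hint' : IntervalIntegrable
      (fun t : ℝ => Complex.imCLM ((k' t : ℂ) * Complex.log ((x : ℂ) - t))) volume a b :=
    ⟨Complex.imCLM.integrable_comp hint.1, Complex.imCLM.integrable_comp hint.2⟩
  have hI : (logPotential a b k' x).im = Real.pi * (k b - k x) := by
    rw [logPotential, ← Complex.imCLM_apply, ← h,
      ← intervalIntegral.integral_add_adjacent_intervals (b := x)
        (hint'.mono_set (by rw [uIcc_of_le hab, uIcc_of_le hx.1.le]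
                            exact Icc_subset_Icc_right hx.2.le))
        (hint'.mono_set (by rw [uIcc_of_le hab, uIcc_of_le hx.2.le]
                            exact Icc_subset_Icc_left hx.1.le))]
    have h1 : ∫ t in a..x, Complex.imCLM ((k' t : ℂ) * Complex.log ((x : ℂ) - t)) = 0 := by
      rw [intervalIntegral.integral_congr (g := fun _ => (0 : ℝ)) fun t ht => ?_]
      · simp
      · rw [uIcc_of_le hx.1.le] at ht
        simp only [Complex.imCLM_apply, Complex.im_ofReal_mul, hpos t ht.2, mul_zero]
    have h2 : ∫ t in x..b, Complex.imCLM ((k' t : ℂ) * Complex.log ((x : ℂ) - t)) =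
        ∫ t in x..b, Real.pi * k' t := by
      refine intervalIntegral.integral_congr_ae (Eventually.of_forall fun t ht => ?_)
      rw [uIoc_of_le hx.2.le] at ht
      simp only [Complex.imCLM_apply, Complex.im_ofReal_mul, hneg t ht.1, mul_comm]
    rw [h1, h2, intervalIntegral.integral_const_mul, hFTC, zero_add]
  rw [Complex.add_im, Complex.sub_im, Complex.im_ofReal_mul, Complex.im_ofReal_mul,
    hpos a hx.1.le, hneg b hx.2, hI]
  ring

theorem exists_holomorphic_inverse {γ : ℂ → ℂ} {D K : Set ℂ} (hD : IsOpen D)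
    (hγ : DifferentiableOn ℂ γ D) (hK : IsCompact K) (hKD : K ⊆ D) (hinj : InjOn γ K)
    (hne : ∀ z ∈ K, deriv γ z ≠ 0) :
    ∃ (O : Set ℂ) (σ : ℂ → ℂ), IsOpen O ∧ DifferentiableOn ℂ σ O ∧
      ∀ z ∈ K, γ z ∈ O ∧ σ (γ z) = z ∧ deriv σ (γ z) = (deriv γ z)⁻¹ := by
  have hstrict : ∀ z ∈ D, HasStrictDerivAt γ (deriv γ z) z := fun z hz =>
    (hγ.analyticAt (hD.mem_nhds hz)).hasStrictDerivAt
  obtain ⟨t, ht, hinjt⟩ := hinj.exists_mem_nhdsSet hK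
    (fun z hz => (hstrict z (hKD hz)).hasDerivAt.continuousAt) fun z hz => by
      let e := ((hstrict z (hKD hz)).hasStrictFDerivAt_equiv (hne z hz)).toOpenPartialHomeomorph γ
      exact ⟨e.source, e.open_source.mem_nhds
        (HasStrictFDerivAt.mem_toOpenPartialHomeomorph_source _), e.injOn⟩
  let T : Set ℂ := interior t ∩ (D ∩ deriv γ ⁻¹' {0}ᶜ)
  have hT : IsOpen T := isOpen_interior.inter
    ((hγ.deriv hD).continuousOn.isOpen_inter_preimage hD isOpen_compl_singleton)
  have hTt : InjOn γ T := hinjt.mono fun z hz => interior_subset hz.1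
  have hKT : K ⊆ T := fun z hz =>
    ⟨subset_interior_iff_mem_nhdsSet.2 ht hz, hKD hz, hne z hz⟩
  let σ : ℂ → ℂ := Function.invFunOn γ T
  have hσ : ∀ z ∈ T, σ (γ z) = z := fun z hz => hTt.leftInvOn_invFunOn hz
  have hmap : ∀ z ∈ T, map γ (𝓝 z) = 𝓝 (γ z) := fun z hz =>
    (hstrict z hz.2.1).map_nhds_eq hz.2.2
  have hO : IsOpen (γ '' T) := by
    refine isOpen_iff_mem_nhds.2 ?_
    rintro _ ⟨z, hz, rfl⟩
    rw [← hmap z hz]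
    exact image_mem_map (hT.mem_nhds hz)
  have hder : ∀ z ∈ T, HasDerivAt σ (deriv γ z)⁻¹ (γ z) := by
    intro z hz
    refine HasDerivAt.of_local_left_inverse (f := γ) ?_ ?_ hz.2.2 ?_
    · rw [ContinuousAt, ← hmap z hz, tendsto_map'_iff, hσ z hz]
      refine tendsto_id.congr' ?_
      filter_upwards [hT.mem_nhds hz] with w hw using (hσ w hw).symm
    · rw [hσ z hz]
      exact (hstrict z hz.2.1).hasDerivAt
    · filter_upwards [hO.mem_nhds (mem_image_of_mem γ hz)]
      rintro _ ⟨w, hw, rfl⟩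
      rw [hσ w hw]
  refine ⟨γ '' T, σ, hO, ?_, fun z hz => ⟨mem_image_of_mem γ (hKT hz), hσ z (hKT hz),
    (hder z (hKT hz)).deriv⟩⟩
  rintro _ ⟨z, hz, rfl⟩
  exact (hder z hz).differentiableAt.differentiableWithinAt

theorem eventually_im_pos_of_lt {σ : ℂ → ℂ} {O : Set ℂ} (hO : IsOpen O)
    (hσ : DifferentiableOn ℂ σ O) {ψ : ℝ → ℝ} {x : ℝ} (hψ : ContinuousAt ψ x)
    (hx : (⟨x, ψ x⟩ : ℂ) ∈ O) (hpos : 0 < (deriv σ ⟨x, ψ x⟩).re)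
    (him : ∀ᶠ y in 𝓝 x, (σ ⟨y, ψ y⟩).im = 0) :
    ∀ᶠ p : ℝ × ℝ in 𝓝 (x, ψ x), ψ p.1 < p.2 → 0 < (σ ⟨p.1, p.2⟩).im := by
  have hι : Continuous fun p : ℝ × ℝ => (⟨p.1, p.2⟩ : ℂ) :=
    Complex.equivRealProdCLM.symm.continuous
  have hd : ContinuousAt (fun w => (deriv σ w).re) ⟨x, ψ x⟩ :=
    Complex.continuous_re.continuousAt.comp
      ((hσ.deriv hO).continuousOn.continuousAt (hO.mem_nhds hx))
  obtain ⟨r, hr, hball⟩ := Metric.mem_nhds_iff.1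
    (inter_mem (hO.mem_nhds hx) (hd.eventually (lt_mem_nhds hpos)))
  have h1 : ∀ᶠ p : ℝ × ℝ in 𝓝 (x, ψ x), (⟨p.1, p.2⟩ : ℂ) ∈ Metric.ball (⟨x, ψ x⟩ : ℂ) r :=
    hι.continuousAt.eventually_mem (Metric.ball_mem_nhds _ hr)
  have hfst : Tendsto Prod.fst (𝓝 (x, ψ x)) (𝓝 x) := continuous_fst.tendsto (x, ψ x)
  have h2 : ∀ᶠ y in 𝓝 x, (⟨y, ψ y⟩ : ℂ) ∈ Metric.ball (⟨x, ψ x⟩ : ℂ) r := by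
    have : ContinuousAt (fun y => (⟨y, ψ y⟩ : ℂ)) x :=
      ContinuousAt.comp (g := fun p : ℝ × ℝ => (⟨p.1, p.2⟩ : ℂ)) (f := fun y => (y, ψ y))
        hι.continuousAt (continuousAt_id.prodMk hψ)
    exact this.eventually_mem (Metric.ball_mem_nhds _ hr)
  filter_upwards [h1, hfst.eventually h2, hfst.eventually him] with p hp1 hp2 hp3 hlt
  have hmem : ∀ s ∈ Icc (ψ p.1) p.2, (⟨p.1, s⟩ : ℂ) ∈ Metric.ball (⟨x, ψ x⟩ : ℂ) r := by
    intro s hs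
    have hseg : s ∈ segment ℝ (ψ p.1) p.2 := by rwa [segment_eq_Icc hlt.le]
    obtain ⟨c, d, hc, hd, hcd, rfl⟩ := hseg
    have := convex_ball (⟨x, ψ x⟩ : ℂ) r hp2 hp1 hc hd hcd
    convert this using 1
    apply Complex.ext
    · simp [← add_mul, hcd]
    · simp
  have hder : ∀ s ∈ Icc (ψ p.1) p.2,
      HasDerivAt (fun s : ℝ => (σ ⟨p.1, s⟩).im) (deriv σ ⟨p.1, s⟩).re s := by
    intro s hs
    have hlin : HasDerivAt (fun s : ℝ => (⟨p.1, s⟩ : ℂ)) Complex.I s := by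
      have : HasDerivAt (fun s : ℝ => (p.1 : ℂ) + s * Complex.I) Complex.I s := by
        simpa using (((hasDerivAt_id s).ofReal_comp).mul_const Complex.I).const_add (p.1 : ℂ)
      refine this.congr_of_eventuallyEq (Eventually.of_forall fun s => ?_)
      exact Complex.mk_eq_add_mul_I _ _
    have hσd := ((hσ.differentiableAt (hO.mem_nhds (hball (hmem s hs)).1)).hasDerivAt).comp s hlin
    have := Complex.imCLM.hasFDerivAt.comp_hasDerivAt s hσd
    rw [show Complex.imCLM (deriv σ ⟨p.1, s⟩ * Complex.I) = (deriv σ ⟨p.1, s⟩).re by simp] at this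
    exact this
  have hmono : StrictMonoOn (fun s : ℝ => (σ ⟨p.1, s⟩).im) (Icc (ψ p.1) p.2) := by
    refine strictMonoOn_of_deriv_pos (convex_Icc _ _)
      (fun s hs => (hder s hs).continuousAt.continuousWithinAt) fun s hs => ?_
    rw [(hder s (interior_subset hs)).deriv]
    exact (hball (hmem s (interior_subset hs))).2
  have := hmono (left_mem_Icc.2 hlt.le) (right_mem_Icc.2 hlt.le) hlt
  simpa [hp3] using this

theorem HasDerivWithinAt.hasFDerivWithinAt_re_mk {f : ℂ → ℂ} {c : ℂ} {S : Set ℂ} {p : ℝ × ℝ}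
    {A : Set (ℝ × ℝ)} (hf : HasDerivWithinAt f c S ⟨p.1, p.2⟩)
    (hA : ∀ q ∈ A, (⟨q.1, q.2⟩ : ℂ) ∈ S) :
    HasFDerivWithinAt (fun q : ℝ × ℝ => (f ⟨q.1, q.2⟩).re)
      (Complex.reCLM ∘L ((ContinuousLinearMap.mul ℝ ℂ c) ∘L
        (Complex.equivRealProdCLM.symm : ℝ × ℝ →L[ℝ] ℂ))) A p := by
  have h1 := hf.hasFDerivWithinAt.restrictScalars ℝ
  have h2 : HasFDerivWithinAt f (ContinuousLinearMap.mul ℝ ℂ c) S ⟨p.1, p.2⟩ := by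
    have h : ContinuousLinearMap.mul ℝ ℂ c =
        (ContinuousLinearMap.toSpanSingleton ℂ c).restrictScalars ℝ := by
      ext x
      simp [mul_comm]
    rw [h]
    exact h1
  have h3 := h2.comp p
    (Complex.equivRealProdCLM.symm : ℝ × ℝ →L[ℝ] ℂ).hasFDerivWithinAt (s := A) hA
  exact Complex.reCLM.hasFDerivAt.comp_hasFDerivWithinAt p h3

theorem pdx_re_mk {f : ℂ → ℂ} {p : ℝ × ℝ} (hf : DifferentiableAt ℂ f ⟨p.1, p.2⟩) :
    pdx (fun q => (f ⟨q.1, q.2⟩).re) p = (deriv f ⟨p.1, p.2⟩).re := by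
  have hlin : HasDerivAt (fun x : ℝ => (⟨x, p.2⟩ : ℂ)) 1 p.1 := by
    have : HasDerivAt (fun x : ℝ => (x : ℂ) + p.2 * Complex.I) 1 p.1 := by
      simpa using ((hasDerivAt_id p.1).ofReal_comp).add_const (p.2 * Complex.I)
    exact this.congr_of_eventuallyEq
      (Eventually.of_forall fun s => Complex.mk_eq_add_mul_I _ _)
  have h := Complex.reCLM.hasFDerivAt.comp_hasDerivAt p.1 (hf.hasDerivAt.comp p.1 hlin)
  rw [mul_one] at h
  exact h.deriv

theorem pdy_re_mk {f : ℂ → ℂ} {p : ℝ × ℝ} (hf : DifferentiableAt ℂ f ⟨p.1, p.2⟩) :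
    pdy (fun q => (f ⟨q.1, q.2⟩).re) p = (deriv f ⟨p.1, p.2⟩ * Complex.I).re := by
  have hlin : HasDerivAt (fun y : ℝ => (⟨p.1, y⟩ : ℂ)) Complex.I p.2 := by
    have : HasDerivAt (fun y : ℝ => (p.1 : ℂ) + y * Complex.I) Complex.I p.2 := by
      simpa using (((hasDerivAt_id p.2).ofReal_comp).mul_const Complex.I).const_add (p.1 : ℂ)
    exact this.congr_of_eventuallyEq
      (Eventually.of_forall fun s => Complex.mk_eq_add_mul_I _ _)
  exact (Complex.reCLM.hasFDerivAt.comp_hasDerivAt p.2 (hf.hasDerivAt.comp p.2 hlin)).deriv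

theorem lap_re_mk {f : ℂ → ℂ} {A : Set ℂ} (hA : IsOpen A) (hf : DifferentiableOn ℂ f A)
    {p : ℝ × ℝ} (hp : (⟨p.1, p.2⟩ : ℂ) ∈ A) : lap (fun q => (f ⟨q.1, q.2⟩).re) p = 0 := by
  have hι : Continuous fun p : ℝ × ℝ => (⟨p.1, p.2⟩ : ℂ) :=
    Complex.equivRealProdCLM.symm.continuous
  have hd : ∀ z ∈ A, DifferentiableAt ℂ f z := fun z hz => hf.differentiableAt (hA.mem_nhds hz)
  have hd' : DifferentiableAt ℂ (deriv f) ⟨p.1, p.2⟩ :=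
    (hf.deriv hA).differentiableAt (hA.mem_nhds hp)
  have hev : ∀ᶠ q : ℝ × ℝ in 𝓝 (p.1, p.2), (⟨q.1, q.2⟩ : ℂ) ∈ A :=
    hι.continuousAt.eventually_mem (hA.mem_nhds hp)
  have hx : ∀ᶠ x in 𝓝 p.1, (⟨x, p.2⟩ : ℂ) ∈ A :=
    (Continuous.prodMk_left p.2).continuousAt.eventually hev
  have hy : ∀ᶠ y in 𝓝 p.2, (⟨p.1, y⟩ : ℂ) ∈ A :=
    (Continuous.prodMk_right p.1).continuousAt.eventually hev
  have h1 : pdx (pdx fun q => (f ⟨q.1, q.2⟩).re) p =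
      pdx (fun q => (deriv f ⟨q.1, q.2⟩).re) p := by
    refine Filter.EventuallyEq.deriv_eq ?_
    filter_upwards [hx] with x hx
    exact pdx_re_mk (p := (x, p.2)) (hd _ hx)
  have h2 : pdy (pdy fun q => (f ⟨q.1, q.2⟩).re) p =
      pdy (fun q => ((fun z => deriv f z * Complex.I) ⟨q.1, q.2⟩).re) p := by
    refine Filter.EventuallyEq.deriv_eq ?_
    filter_upwards [hy] with y hy
    exact pdy_re_mk (p := (p.1, y)) (hd _ hy)
  rw [lap, h1, h2, pdx_re_mk hd', pdy_re_mk (hd'.mul_const _), deriv_mul_const hd', mul_assoc,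
    Complex.I_mul_I]
  simp

theorem contDiffOn_re_mk {f : ℂ → ℂ} {A : Set ℂ} (hA : IsOpen A) (hf : DifferentiableOn ℂ f A)
    {B : Set (ℝ × ℝ)} (hB : ∀ q ∈ B, (⟨q.1, q.2⟩ : ℂ) ∈ A) :
    ContDiffOn ℝ 2 (fun q : ℝ × ℝ => (f ⟨q.1, q.2⟩).re) B := by
  have h1 : ContDiffOn ℝ 2 f A := (hf.contDiffOn (n := 2) hA).restrict_scalars ℝ
  have h2 : ContDiffOn ℝ 2 (fun q : ℝ × ℝ => f ⟨q.1, q.2⟩) B :=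
    h1.comp (Complex.equivRealProdCLM.symm : ℝ × ℝ →L[ℝ] ℂ).contDiff.contDiffOn hB
  exact Complex.reCLM.contDiff.comp_contDiffOn h2

theorem integral_mul_log_sqrt_eq {Ψ k : ℝ → ℝ} {V : Set ℝ} {a b : ℝ} (hab : a ≤ b)
    (hV : IsOpen V) (habV : Icc a b ⊆ V) (hΨ : DifferentiableOn ℝ Ψ V)
    (hk : ContinuousOn k (Icc a b)) {x : ℝ} (hx : x ∈ V) :
    ∫ t in a..b, k t * Real.log (Real.sqrt ((x - t) ^ 2 + (Ψ x - Ψ t) ^ 2)) =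
      (∫ t in a..b, k t * Real.log (x - t)) +
        1 / 2 * ∫ t in a..b, k t * Real.log (1 + slope Ψ t x ^ 2) := by
  have hae : ∀ᵐ t : ℝ, t ≠ x := by simp [ae_iff, measure_singleton]
  have hsl : ∀ t : ℝ, t ≠ x → slope Ψ t x = dslope Ψ x t := fun t ht => by
    rw [dslope_of_ne _ ht, slope_comm]
  have h1 : ∫ t in a..b, k t * Real.log (1 + slope Ψ t x ^ 2) =
      ∫ t in a..b, k t * Real.log (1 + dslope Ψ x t ^ 2) := by
    refine intervalIntegral.integral_congr_ae ?_
    filter_upwards [hae] with t ht _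
    rw [hsl t ht]
  have h2 : ∫ t in a..b, k t * Real.log (Real.sqrt ((x - t) ^ 2 + (Ψ x - Ψ t) ^ 2)) =
      ∫ t in a..b, (k t * Real.log (x - t) + 1 / 2 * (k t * Real.log (1 + dslope Ψ x t ^ 2))) := by
    refine intervalIntegral.integral_congr_ae ?_
    filter_upwards [hae] with t ht _
    have hne : x - t ≠ 0 := sub_ne_zero.2 ht.symm
    have hfac : (x - t) ^ 2 + (Ψ x - Ψ t) ^ 2 = (x - t) ^ 2 * (1 + dslope Ψ x t ^ 2) := by
      rw [← hsl t ht, slope_def_field]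
      field_simp
    rw [Real.log_sqrt (by positivity), hfac, Real.log_mul (by positivity) (by positivity),
      Real.log_pow]
    push_cast
    ring
  have hi1 : IntervalIntegrable (fun t => k t * Real.log (x - t)) volume a b := by
    have h0 : IntervalIntegrable Real.log volume (x - a) (x - b) :=
      intervalIntegral.intervalIntegrable_log'
    have h := h0.comp_sub_left x
    simp only [sub_sub_cancel] at h
    exact h.continuousOn_mul (by rwa [uIcc_of_le hab])
  have hi2 : IntervalIntegrable (fun t => k t * Real.log (1 + dslope Ψ x t ^ 2)) volume a b := by
    refine ContinuousOn.intervalIntegrable ?_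
    rw [uIcc_of_le hab]
    have hd : ContinuousOn (dslope Ψ x) V := (continuousOn_dslope (hV.mem_nhds hx)).2
      ⟨hΨ.continuousOn, hΨ.differentiableAt (hV.mem_nhds hx)⟩
    refine hk.mul (ContinuousOn.log ?_ fun t _ => by positivity)
    exact continuousOn_const.add ((hd.mono habV).pow 2)
  rw [h1, h2, intervalIntegral.integral_add hi1 (hi2.const_mul _),
    intervalIntegral.integral_const_mul]

/-- Solution of the Cauchy problem on a segment of the real axis: the function `Re W` has boundary
values `g` and normal derivative `k`. -/
theorem exists_cauchy_solution_segment {a b : ℝ} (hab : a ≤ b) {g k : ℝ → ℝ}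
    (hk : ContDiffOn ℝ 1 k (Icc a b))
    (han : AnalyticOnNhd ℝ (fun x => g x - (1 / Real.pi) * ∫ t in a..b, k t * Real.log (x - t))
      (Ioo a b)) :
    ∃ (D : Set ℂ) (W d : ℂ → ℂ), IsOpen D ∧ (∀ x ∈ Ioo a b, (x : ℂ) ∈ D) ∧
      (∀ z ∈ D, 0 ≤ z.im → HasDerivWithinAt W (d z) {z | 0 ≤ z.im} z) ∧
      ContinuousOn d (D ∩ {z | 0 ≤ z.im}) ∧
      (∀ x ∈ Ioo a b, (W x).re = g x) ∧ ∀ x ∈ Ioo a b, (d x).im = -k x := by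
  rcases hab.eq_or_lt with rfl | hlt
  · exact ⟨∅, 0, 0, isOpen_empty, by simp, by simp, by simp, by simp, by simp⟩
  obtain ⟨D, G, hD, hsub, hG, hGH⟩ := han.exists_complex_extension isOpen_Ioo
  let k' : ℝ → ℝ := derivWithin k (Icc a b)
  have hk' : ContinuousOn k' (Icc a b) :=
    hk.continuousOn_derivWithin (uniqueDiffOn_Icc hlt) le_rfl
  have hkd : ∀ t ∈ Icc a b, HasDerivWithinAt k (k' t) (Icc a b) t := fun t ht =>
    (hk.differentiableOn one_ne_zero t ht).hasDerivWithinAt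
  let E : ℂ → ℂ := fun z => k a * Complex.log (z - a) - k b * Complex.log (z - b) +
    logPotential a b k' z
  have hmem : ∀ x ∈ Ioo a b, (x : ℂ) ∈ D ∩ {(a : ℂ), (b : ℂ)}ᶜ := by
    intro x hx
    refine ⟨hsub x hx, ?_⟩
    simp only [mem_compl_iff, mem_insert_iff, mem_singleton_iff, Complex.ofReal_inj, not_or]
    exact ⟨hx.1.ne', hx.2.ne⟩
  have hne : ∀ z ∈ D ∩ {(a : ℂ), (b : ℂ)}ᶜ, z ≠ a ∧ z ≠ b := by
    intro z hz
    simpa [not_or] using hz.2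
  have hGd : ∀ z ∈ D, HasDerivAt G (deriv G z) z := fun z hz =>
    (hG.differentiableAt (hD.mem_nhds hz)).hasDerivAt
  refine ⟨D ∩ {(a : ℂ), (b : ℂ)}ᶜ, fun z => G z + (Real.pi⁻¹ : ℝ) * logPotential a b k z,
    fun z => deriv G z + (Real.pi⁻¹ : ℝ) * E z,
    hD.inter ((Set.finite_singleton _).insert _).isClosed.isOpen_compl, hmem, ?_, ?_, ?_, ?_⟩
  · intro z hz him
    exact (hGd z hz.1).hasDerivWithinAt.add
      ((hasDerivWithinAt_logPotential hab hkd hk' him (hne z hz).1 (hne z hz).2).const_mul _)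
  · rintro z ⟨hz, him⟩
    refine ContinuousWithinAt.add ?_ (continuousWithinAt_const.mul ?_)
    · exact ((hG.deriv hD).differentiableAt (hD.mem_nhds hz.1)).continuousAt.continuousWithinAt
    · exact (continuousWithinAt_logPotential_deriv hab k hk' him (hne z hz).1 (hne z hz).2).mono
        inter_subset_right
  · intro x hx
    rw [Complex.add_re, Complex.re_ofReal_mul, hGH x hx, Complex.ofReal_re,
      re_logPotential_ofReal hab hk.continuousOn]
    ring
  · intro x hx
    have hreal : deriv G x = ((deriv (fun x => g x - (1 / Real.pi) *
        ∫ t in a..b, k t * Real.log (x - t)) x : ℝ) : ℂ) :=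
      deriv_eq_ofReal_of_eqOn isOpen_Ioo hx (hGd x (hsub x hx)).differentiableAt
        (han x hx).differentiableAt hGH
    rw [Complex.add_im, Complex.im_ofReal_mul, hreal, Complex.ofReal_im,
      im_logPotential_deriv_ofReal hkd hk' hx]
    field_simp
    ring

/-- A compact real analytic graph is straightened to the real axis by a holomorphic function. -/
theorem exists_holomorphic_straightening {a b : ℝ} {V : Set ℝ} {Ψ : ℝ → ℝ} (hV : IsOpen V)
    (habV : Icc a b ⊆ V) (hΨ : AnalyticOnNhd ℝ Ψ V) :
    ∃ (O : Set ℂ) (σ : ℂ → ℂ), IsOpen O ∧ DifferentiableOn ℂ σ O ∧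
      ∀ x ∈ Icc a b, (⟨x, Ψ x⟩ : ℂ) ∈ O ∧ σ ⟨x, Ψ x⟩ = x ∧
        deriv σ ⟨x, Ψ x⟩ = (1 + (deriv Ψ x : ℝ) * Complex.I)⁻¹ := by
  obtain ⟨D, P, hD, hsub, hP, hPΨ⟩ := hΨ.exists_complex_extension hV
  have hPd : ∀ x ∈ V, HasDerivAt P (deriv Ψ x : ℝ) x := fun x hx => by
    have hd := hP.differentiableAt (hD.mem_nhds (hsub x hx))
    rw [← deriv_eq_ofReal_of_eqOn hV hx hd (hΨ x hx).differentiableAt hPΨ]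
    exact hd.hasDerivAt
  let γ : ℂ → ℂ := fun z => z + P z * Complex.I
  have hγ : ∀ x ∈ V, γ x = ⟨x, Ψ x⟩ := fun x hx => by
    simp only [γ, hPΨ x hx]
    exact (Complex.mk_eq_add_mul_I _ _).symm
  have hγd : ∀ x ∈ V, deriv γ x = 1 + (deriv Ψ x : ℝ) * Complex.I := fun x hx =>
    ((hasDerivAt_id _).add ((hPd x hx).mul_const _)).deriv
  obtain ⟨O, σ, hO, hσ, h⟩ := exists_holomorphic_inverse (γ := γ) (K := Complex.ofReal '' Icc a b)
    hD (differentiableOn_id.add (hP.mul_const _))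
    (isCompact_Icc.image Complex.continuous_ofReal)
    (by rintro _ ⟨x, hx, rfl⟩; exact hsub x (habV hx))
    (by
      rintro _ ⟨x, hx, rfl⟩ _ ⟨y, hy, rfl⟩ hxy
      rw [hγ x (habV hx), hγ y (habV hy)] at hxy
      exact congrArg _ (Complex.ext_iff.1 hxy).1)
    (by
      rintro _ ⟨x, hx, rfl⟩ h0
      rw [hγd x (habV hx)] at h0
      simpa using congrArg Complex.re h0)
  refine ⟨O, σ, hO, hσ, fun x hx => ?_⟩
  have := h x (mem_image_of_mem _ hx)
  rwa [hγ x (habV hx), hγd x (habV hx)] at this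

/-- The logarithmic potentials of a density on an analytic graph and on its projection to the real
axis differ by an analytic function. -/
theorem analyticOnNhd_sub_integral_mul_log {a b c : ℝ} (hab : a ≤ b) {V : Set ℝ} {Ψ g k : ℝ → ℝ}
    (hV : IsOpen V) (habV : Icc a b ⊆ V) (hΨ : AnalyticOnNhd ℝ Ψ V)
    (hk : ContinuousOn k (Icc a b))
    (hH : AnalyticOnNhd ℝ (fun x => g x - c * ∫ t in a..b,
      k t * Real.log (Real.sqrt ((x - t) ^ 2 + (Ψ x - Ψ t) ^ 2))) (Ioo a b)) :
    AnalyticOnNhd ℝ (fun x => g x - c * ∫ t in a..b, k t * Real.log (x - t)) (Ioo a b) := by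
  obtain ⟨D, P, hD, hsub, hP, hPΨ⟩ := hΨ.exists_complex_extension hV
  intro x hx
  have hxV : Ioo a b ⊆ V := Ioo_subset_Icc_self.trans habV
  have h1 := analyticAt_integral_mul_log_one_add_sq_slope hab hV habV hD hsub hP hPΨ
    hΨ.differentiableOn hk (hxV hx)
  refine ((hH x hx).add (analyticAt_const (v := c / 2) |>.mul h1)).congr ?_
  filter_upwards [isOpen_Ioo.mem_nhds hx] with y hy
  simp only [Pi.add_apply, Pi.mul_apply]
  rw [integral_mul_log_sqrt_eq hab hV habV hΨ.differentiableOn hk (hxV hy)]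
  ring

/-- sufficiency direction of the Hadamard-type theorem.
If `H(x) = g(x) - (1/π) ∫_{-1}^1 h(t) √(1+Ψ'(t)²) log √((x-t)² + (Ψ(x)-Ψ(t))²) dt`
is real analytic on `(-1,1)`, then the Cauchy problem for the Laplacian with Dirichlet data `g`
and Neumann data `h` on the analytic graph `Γ = {(x, Ψ x) : x ∈ (-1,1)}` has a solution on some
open connected neighbourhood `U` of `Γ`, of class `C²` on `U ∖ cl Ω` and `C¹` on `U ∖ Ω`. -/
theorem stmt1
    (Ψ g h : ℝ → ℝ)
    (hΨ : ∃ V : Set ℝ, IsOpen V ∧ Set.Icc (-1 : ℝ) 1 ⊆ V ∧ AnalyticOnNhd ℝ Ψ V)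
    (hg : ContDiffOn ℝ 1 g (Set.Icc (-1 : ℝ) 1))
    (hh : ContDiffOn ℝ 1 h (Set.Icc (-1 : ℝ) 1))
    (Γ : Set (ℝ × ℝ)) (hΓ : Γ = {p : ℝ × ℝ | p.1 ∈ Set.Ioo (-1 : ℝ) 1 ∧ p.2 = Ψ p.1})
    (Ω : Set (ℝ × ℝ)) (hΩ : Ω = {p : ℝ × ℝ | p.1 ∈ Set.Ioo (-1 : ℝ) 1 ∧ p.2 < Ψ p.1})
    (hH : AnalyticOnNhd ℝ
      (fun x => g x - (1 / Real.pi) * ∫ t in (-1 : ℝ)..1,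
        h t * Real.sqrt (1 + deriv Ψ t ^ 2) *
          Real.log (Real.sqrt ((x - t) ^ 2 + (Ψ x - Ψ t) ^ 2)))
      (Set.Ioo (-1 : ℝ) 1)) :
    ∃ (U : Set (ℝ × ℝ)) (u : ℝ × ℝ → ℝ) (u' : ℝ × ℝ → ℝ × ℝ →L[ℝ] ℝ),
      IsOpen U ∧ IsConnected U ∧ Γ ⊆ U ∧
      -- u ∈ C²(U ∖ cl Ω)
      ContDiffOn ℝ 2 u (U \ closure Ω) ∧
      -- u ∈ C¹(U ∖ Ω): u has continuous derivative u' up to the boundary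
      (∀ p ∈ U \ Ω, HasFDerivWithinAt u (u' p) (U \ Ω) p) ∧
      ContinuousOn u' (U \ Ω) ∧
      -- Δu = 0 on U ∖ cl Ω
      (∀ p ∈ U \ closure Ω, lap u p = 0) ∧
      -- u(x, Ψ x) = g x
      (∀ x ∈ Set.Ioo (-1 : ℝ) 1, u (x, Ψ x) = g x) ∧
      -- ∂u/∂n (x, Ψ x) = h x, where n(x) = (−Ψ'(x), 1)/√(1+Ψ'(x)²) points away from Ω
      (∀ x ∈ Set.Ioo (-1 : ℝ) 1,
        u' (x, Ψ x) ((Real.sqrt (1 + deriv Ψ x ^ 2))⁻¹ • (-(deriv Ψ x), (1 : ℝ))) = h x) := by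
  obtain ⟨V, hV, hIV, hΨV⟩ := hΨ
  let k : ℝ → ℝ := fun t => h t * Real.sqrt (1 + deriv Ψ t ^ 2)
  have hpos : ∀ t, 0 < 1 + deriv Ψ t ^ 2 := fun t => by positivity
  have hk : ContDiffOn ℝ 1 k (Icc (-1) 1) := by
    have hd : ContDiffOn ℝ 1 (deriv Ψ) (Icc (-1) 1) :=
      (hΨV.deriv.contDiffOn hV.uniqueDiffOn).mono hIV
    exact hh.mul ((contDiffOn_const.add (hd.pow 2)).sqrt fun t _ => (hpos t).ne')
  obtain ⟨D, W, d, hD, hID, hW, hd, hWg, hdk⟩ := exists_cauchy_solution_segment (by norm_num) hk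
    (analyticOnNhd_sub_integral_mul_log (by norm_num) hV hIV hΨV hk.continuousOn hH)
  obtain ⟨O, σ, hO, hσ, hσΨ⟩ := exists_holomorphic_straightening hV hIV hΨV
  have hσc : ∀ z ∈ O, ContinuousAt σ z := fun z hz =>
    (hσ.differentiableAt (hO.mem_nhds hz)).continuousAt
  have hI : ∀ x ∈ Ioo (-1 : ℝ) 1, x ∈ Icc (-1 : ℝ) 1 := fun x hx => Ioo_subset_Icc_self hx
  have hΨc : ∀ x ∈ Ioo (-1 : ℝ) 1, ContinuousAt Ψ x := fun x hx =>
    (hΨV x (hIV (hI x hx))).continuousAt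
  let ι : ℝ × ℝ → ℂ := fun q => ⟨q.1, q.2⟩
  have hι : Continuous ι := Complex.equivRealProdCLM.symm.continuous
  let Q : Set (ℝ × ℝ) := {q | q.1 ∈ Ioo (-1 : ℝ) 1 ∧ ι q ∈ O ∧ σ (ι q) ∈ D ∧
    (Ψ q.1 < q.2 → 0 < (σ (ι q)).im)}
  have hΓQ : Γ ⊆ interior Q := by
    rintro ⟨x, y⟩ hp
    obtain ⟨hx, rfl⟩ : x ∈ Ioo (-1 : ℝ) 1 ∧ y = Ψ x := by rwa [hΓ] at hp
    obtain ⟨hxO, hσx, hσ'⟩ := hσΨ x (hI x hx)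
    have hpos' : 0 < (deriv σ ⟨x, Ψ x⟩).re := by
      rw [hσ', Complex.inv_re]
      refine div_pos (by simp) (Complex.normSq_pos.2 fun h0 => ?_)
      simpa using congrArg Complex.re h0
    have him : ∀ᶠ y in 𝓝 x, (σ ⟨y, Ψ y⟩).im = 0 := by
      filter_upwards [isOpen_Ioo.mem_nhds hx] with y hy
      rw [(hσΨ y (hI y hy)).2.1, Complex.ofReal_im]
    have hσD : ∀ᶠ q in 𝓝 (x, Ψ x), σ (ι q) ∈ D := by
      refine ((hσc _ hxO).comp_of_eq hι.continuousAt rfl).eventually_mem (hD.mem_nhds ?_)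
      simpa only [Function.comp_apply, ι, hσx] using hID x hx
    refine mem_interior_iff_mem_nhds.2 ?_
    filter_upwards [continuous_fst.continuousAt.eventually_mem (isOpen_Ioo.mem_nhds hx),
      hι.continuousAt.eventually_mem (hO.mem_nhds hxO), hσD,
      eventually_im_pos_of_lt hO hσ (hΨc x hx) hxO hpos' him] with q h1 h2 h3 h4
    exact ⟨h1, h2, h3, h4⟩
  have hΓc : IsPreconnected Γ := by
    have : Γ = (fun x => (x, Ψ x)) '' Ioo (-1 : ℝ) 1 := by
      rw [hΓ]
      ext ⟨x, y⟩
      simp only [mem_ofPred_eq, mem_image, Prod.mk.injEq]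
      constructor
      · rintro ⟨hx, rfl⟩
        exact ⟨x, hx, rfl, rfl⟩
      · rintro ⟨x, hx, rfl, rfl⟩
        exact ⟨hx, rfl⟩
    rw [this]
    exact isPreconnected_Ioo.image _
      (continuousOn_id.prodMk fun x hx => (hΨc x hx).continuousWithinAt)
  have h0 : ((0 : ℝ), Ψ 0) ∈ Γ := by
    rw [hΓ]
    exact ⟨by norm_num, rfl⟩
  let U := connectedComponentIn (interior Q) (0, Ψ 0)
  have hUQ : U ⊆ Q := (connectedComponentIn_subset _ _).trans interior_subset
  have hΓU : Γ ⊆ U := hΓc.subset_connectedComponentIn h0 hΓQ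
  let S : Set ℂ := {z | z ∈ O ∧ σ z ∈ D ∧ 0 ≤ (σ z).im}
  have hUS : ∀ p ∈ U \ Ω, ι p ∈ S := by
    rintro ⟨x, y⟩ ⟨hp, hpΩ⟩
    obtain ⟨hx, hpO, hpD, him⟩ := hUQ hp
    refine ⟨hpO, hpD, ?_⟩
    have hle : Ψ x ≤ y := by
      by_contra! hlt
      exact hpΩ (by rw [hΩ]; exact ⟨hx, hlt⟩)
    rcases hle.eq_or_lt with rfl | hlt
    · simp only [ι]
      rw [(hσΨ x (hI x hx)).2.1, Complex.ofReal_im]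
    · exact (him hlt).le
  let A : Set ℂ := {z | z ∈ O ∧ σ z ∈ D ∧ 0 < (σ z).im}
  have hA : IsOpen A := by
    have : A = O ∩ σ ⁻¹' (D ∩ {z | 0 < z.im}) := by
      ext z
      rfl
    rw [this]
    exact hσ.continuousOn.isOpen_inter_preimage hO
      (hD.inter (isOpen_lt continuous_const Complex.continuous_im))
  have hWA : DifferentiableOn ℂ (W ∘ σ) A := by
    rintro z ⟨hzO, hzD, him⟩
    have h1 : HasDerivAt W (d (σ z)) (σ z) := by
      refine (hW _ hzD him.le).hasDerivAt ?_
      filter_upwards [(isOpen_lt continuous_const Complex.continuous_im).mem_nhds him] with w hw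
      exact le_of_lt hw
    exact (h1.differentiableAt.comp z
      (hσ.differentiableAt (hO.mem_nhds hzO))).differentiableWithinAt
  have hUA : ∀ p ∈ U \ closure Ω, ι p ∈ A := by
    rintro ⟨x, y⟩ ⟨hp, hpΩ⟩
    obtain ⟨hx, hpO, hpD, him⟩ := hUQ hp
    refine ⟨hpO, hpD, him ?_⟩
    by_contra! hle
    refine hpΩ (mem_closure_of_tendsto (b := 𝓝[<] y) (f := fun s => (x, s))
      ((Continuous.prodMk_right x).continuousAt.mono_left nhdsWithin_le_nhds) ?_)
    filter_upwards [self_mem_nhdsWithin] with s hs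
    rw [hΩ]
    exact ⟨hx, lt_of_lt_of_le hs hle⟩
  have hWS : ∀ z ∈ S, HasDerivWithinAt (W ∘ σ) (d (σ z) * deriv σ z) S z := fun z hz =>
    (hW _ hz.2.1 hz.2.2).comp z
      (hσ.differentiableAt (hO.mem_nhds hz.1)).hasDerivAt.hasDerivWithinAt fun w hw => hw.2.2
  have hdS : ContinuousOn (fun z => d (σ z) * deriv σ z) S :=
    (hd.comp (hσ.continuousOn.mono fun z hz => hz.1) fun z hz => hz.2).mul
      ((hσ.deriv hO).continuousOn.mono fun z hz => hz.1)
  refine ⟨U, fun q => ((W ∘ σ) ⟨q.1, q.2⟩).re, fun p => Complex.reCLM ∘L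
    ((ContinuousLinearMap.mul ℝ ℂ (d (σ (ι p)) * deriv σ (ι p))) ∘L
      (Complex.equivRealProdCLM.symm : ℝ × ℝ →L[ℝ] ℂ)), isOpen_interior.connectedComponentIn,
    isConnected_connectedComponentIn_iff.2 (hΓQ h0), hΓU, contDiffOn_re_mk hA hWA hUA,
    fun p hp => (hWS _ (hUS p hp)).hasFDerivWithinAt_re_mk hUS, ?_,
    fun p hp => lap_re_mk hA hWA (hUA p hp), fun x hx => ?_, fun x hx => ?_⟩
  · exact continuousOn_const.clm_comp (((ContinuousLinearMap.mul ℝ ℂ).continuous.comp_continuousOn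
      (hdS.comp hι.continuousOn hUS)).clm_comp continuousOn_const)
  · simp only [Function.comp_apply]
    rw [(hσΨ x (hI x hx)).2.1, hWg x hx]
  · obtain ⟨-, hσx, hσ'⟩ := hσΨ x (hI x hx)
    have hn : (Complex.equivRealProdCLM.symm : ℝ × ℝ →L[ℝ] ℂ)
        ((Real.sqrt (1 + deriv Ψ x ^ 2))⁻¹ • (-(deriv Ψ x), (1 : ℝ))) =
        ((Real.sqrt (1 + deriv Ψ x ^ 2))⁻¹ : ℝ) *
          ((1 + (deriv Ψ x : ℝ) * Complex.I) * Complex.I) := by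
      apply Complex.ext <;> simp
    have hne : (1 + (deriv Ψ x : ℝ) * Complex.I) ≠ 0 := fun h0 => by
      simpa using congrArg Complex.re h0
    have hmul : d x * (1 + (deriv Ψ x : ℝ) * Complex.I)⁻¹ *
        (((Real.sqrt (1 + deriv Ψ x ^ 2))⁻¹ : ℝ) *
          ((1 + (deriv Ψ x : ℝ) * Complex.I) * Complex.I)) =
        ((Real.sqrt (1 + deriv Ψ x ^ 2))⁻¹ : ℝ) * (d x * Complex.I) := by
      field_simp
    simp only [ContinuousLinearMap.comp_apply, hn, ContinuousLinearMap.mul_apply', ι, hσx, hσ',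
      hmul, Complex.reCLM_apply, Complex.re_ofReal_mul, Complex.mul_I_re, hdk x hx, neg_neg, k]
    field_simp [(Real.sqrt_pos.2 (hpos x)).ne']
end
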